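/- arXiv:1610.06900 — 3 statements merged into one kernel-verified Lean document; each statement's English description precedes it below -/
import Mathlib

section
/- Let Φ and Ψ be fixed smooth nonnegative real functions compactly supported in (0,∞), and fix A > 0. (i) For every positive integer p there is a constant C_p such that uniformly for complex s₁ = σ₁ + it₁, s₂ = σ₂ + it₂ with −A ≤ σ₁, σ₂ ≤ A and all real u ≥ 0, one has |W̃₂(s₁,s₂;u)| ≤ C_p · u^{p−1} / (1 + max(|t₁|,|t₂|)^p). (ii) There is a constant K > 0 such that W̃₂(s₁,s₂;u) = 0 for all s₁, s₂ whenever 0 ≤ u < K. -/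
open MeasureTheory Complex

/-- `W(x,y;u) = Ψ(x)Ψ(y)Φ(u|x−y|)`. -/
noncomputable def Wfun (Φ Ψ : ℝ → ℝ) (x y u : ℝ) : ℝ := Ψ x * Ψ y * Φ (u * |x - y|)

/-- Double Mellin transform
`W̃₂(s₁,s₂;u) = ∫₀^∞∫₀^∞ W(x,y;u) x^{s₁−1} y^{s₂−1} dx dy`. -/
noncomputable def W2Tilde (Φ Ψ : ℝ → ℝ) (s₁ s₂ : ℂ) (u : ℝ) : ℂ :=
  ∫ x in Set.Ioi (0 : ℝ), ∫ y in Set.Ioi (0 : ℝ),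
    ((Wfun Φ Ψ x y u : ℝ) : ℂ) * (x : ℂ)^(s₁ - 1) * (y : ℂ)^(s₂ - 1)

lemma continuous_ofReal_mul_cpow {f : ℝ → ℝ} (hf : Continuous f)
    (hpos : tsupport f ⊆ Set.Ioi 0) (s : ℂ) :
    Continuous fun x : ℝ => (f x : ℂ) * (x : ℂ) ^ s := by
  refine continuous_of_tsupport fun x hx => ?_
  have hx' : x ∈ tsupport fun x : ℝ => (f x : ℂ) := tsupport_mul_subset_left hx
  have hx0 : 0 < x := hpos (tsupport_comp_subset (g := ((↑) : ℝ → ℂ)) ofReal_zero f hx')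
  exact (continuous_ofReal.comp hf).continuousAt.mul
    (continuousAt_ofReal_cpow_const _ _ (Or.inr hx0.ne'))

lemma integrable_ofReal_mul_cpow {f : ℝ → ℝ} (hf : Continuous f) (hc : HasCompactSupport f)
    (hpos : tsupport f ⊆ Set.Ioi 0) (s : ℂ) :
    Integrable fun x : ℝ => (f x : ℂ) * (x : ℂ) ^ s :=
  (continuous_ofReal_mul_cpow hf hpos s).integrable_of_hasCompactSupport
    ((hc.comp_left (g := ((↑) : ℝ → ℂ)) ofReal_zero).mul_right)

lemma tsupport_iteratedDeriv_subset (f : ℝ → ℝ) (p : ℕ) :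
    tsupport (iteratedDeriv p f) ⊆ tsupport f := by
  induction p with
  | zero => simp
  | succ p ih =>
    rw [iteratedDeriv_succ]
    exact tsupport_deriv_subset.trans ih

lemma eq_zero_of_nonpos_of_tsupport {f : ℝ → ℝ} (hpos : tsupport f ⊆ Set.Ioi 0) {x : ℝ}
    (hx : x ≤ 0) : f x = 0 :=
  image_eq_zero_of_notMem_tsupport fun h => not_lt.2 hx (hpos h)

/-- Integration by parts for the Mellin transform. -/
lemma mul_integral_mul_cpow_eq {f : ℝ → ℝ} (hf : ContDiff ℝ (⊤ : ℕ∞) f)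
    (hc : HasCompactSupport f) (hpos : tsupport f ⊆ Set.Ioi 0) (s : ℂ) :
    s * ∫ x in Set.Ioi (0 : ℝ), (f x : ℂ) * (x : ℂ) ^ (s - 1) =
      -∫ x in Set.Ioi (0 : ℝ), ((deriv f x : ℝ) : ℂ) * (x : ℂ) ^ s := by
  have hpos' : tsupport (deriv f) ⊆ Set.Ioi 0 := tsupport_deriv_subset.trans hpos
  have hf' : Continuous (deriv f) := hf.continuous_deriv (by simp)
  rw [setIntegral_eq_integral_of_forall_compl_eq_zero (f := fun x : ℝ => (f x : ℂ) * _),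
    setIntegral_eq_integral_of_forall_compl_eq_zero]
  · have h1 := integrable_ofReal_mul_cpow hf.continuous hc hpos (s - 1)
    have h2 := integrable_ofReal_mul_cpow hf' hc.deriv hpos' s
    have h3 := integrable_ofReal_mul_cpow hf.continuous hc hpos s
    rw [eq_neg_iff_add_eq_zero, ← integral_const_mul, ← integral_add (h1.const_mul s) h2]
    refine integral_eq_zero_of_hasDerivAt_of_integrable (fun x => ?_)
      ((h1.const_mul s).add h2) h3
    by_cases hx : x ∈ tsupport f
    · have hx0 : 0 < x := hpos hx
      have hd : HasDerivAt (fun y : ℝ => (f y : ℂ)) ((deriv f x : ℝ) : ℂ) x :=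
        ((hf.differentiable (by simp)) x).hasDerivAt.ofReal_comp
      have hp : HasDerivAt (fun y : ℝ => (y : ℂ) ^ s) (s * (x : ℂ) ^ (s - 1)) x := by
        rcases eq_or_ne s 0 with rfl | hs
        · simpa using hasDerivAt_const x (1 : ℂ)
        · exact hasDerivAt_ofReal_cpow_const hx0.ne' hs
      refine (hd.fun_mul hp).congr_deriv ?_
      ring
    · have hz := notMem_tsupport_iff_eventuallyEq.1 hx
      have hz' : deriv f x = 0 := by simpa using hz.deriv_eq
      have : (fun y : ℝ => (f y : ℂ) * (y : ℂ) ^ s) =ᶠ[nhds x] fun _ => 0 := by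
        filter_upwards [hz] with y hy
        simp [hy]
      simpa [hz.eq_of_nhds, hz'] using (hasDerivAt_const x (0 : ℂ)).congr_of_eventuallyEq this
  · intro x hx
    simp [eq_zero_of_nonpos_of_tsupport hpos' (not_lt.1 hx)]
  · intro x hx
    simp [eq_zero_of_nonpos_of_tsupport hpos (not_lt.1 hx)]

lemma abs_im_pow_mul_norm_integral_mul_cpow_le (p : ℕ) : ∀ {f : ℝ → ℝ},
    ContDiff ℝ (⊤ : ℕ∞) f → HasCompactSupport f → tsupport f ⊆ Set.Ioi 0 → ∀ s : ℂ,
    |s.im| ^ p * ‖∫ x in Set.Ioi (0 : ℝ), (f x : ℂ) * (x : ℂ) ^ (s - 1)‖ ≤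
      ‖∫ x in Set.Ioi (0 : ℝ), ((iteratedDeriv p f x : ℝ) : ℂ) * (x : ℂ) ^ (s + p - 1)‖ := by
  induction p with
  | zero => intros; simp
  | succ p ih =>
    intro f hf hc hpos s
    have hf' : ContDiff ℝ (⊤ : ℕ∞) (deriv f) := (contDiff_infty_iff_deriv.1 hf).2
    have hi := ih hf' hc.deriv (tsupport_deriv_subset.trans hpos) (s + 1)
    have he : ‖s‖ * ‖∫ x in Set.Ioi (0 : ℝ), (f x : ℂ) * (x : ℂ) ^ (s - 1)‖ =
        ‖∫ x in Set.Ioi (0 : ℝ), ((deriv f x : ℝ) : ℂ) * (x : ℂ) ^ s‖ := by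
      rw [← norm_mul, mul_integral_mul_cpow_eq hf hc hpos, norm_neg]
    rw [iteratedDeriv_succ', show s + ((p + 1 : ℕ) : ℂ) - 1 = s + 1 + p - 1 by push_cast; ring]
    refine le_trans ?_ hi
    rw [add_sub_cancel_right, ← he, add_im, one_im, add_zero, pow_succ, mul_assoc]
    gcongr
    exact abs_im_le_norm s

lemma exists_rpow_le {α β : ℝ} (hα : 0 < α) (R : ℝ) :
    ∃ M, 0 ≤ M ∧ ∀ x ∈ Set.Icc α β, ∀ r : ℝ, |r| ≤ R → x ^ r ≤ M := by
  refine ⟨Real.exp ((|Real.log α| + |Real.log β|) * R), (Real.exp_pos _).le, ?_⟩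
  rintro x ⟨h1, h2⟩ r hr
  have hx : 0 < x := hα.trans_le h1
  rw [Real.rpow_def_of_pos hx, Real.exp_le_exp]
  have hl : |Real.log x| ≤ |Real.log α| + |Real.log β| := by
    have h3 := Real.log_le_log hα h1
    have h4 := Real.log_le_log hx h2
    have := neg_abs_le (Real.log α)
    have := le_abs_self (Real.log β)
    have := abs_nonneg (Real.log α)
    have := abs_nonneg (Real.log β)
    rw [abs_le]
    constructor <;> linarith
  calc Real.log x * r ≤ |Real.log x * r| := le_abs_self _
    _ = |Real.log x| * |r| := abs_mul _ _
    _ ≤ _ := by gcongr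

lemma exists_tsupport_subset_Icc {f : ℝ → ℝ} (hc : HasCompactSupport f)
    (hpos : tsupport f ⊆ Set.Ioi 0) :
    ∃ α β : ℝ, 0 < α ∧ α ≤ β ∧ tsupport f ⊆ Set.Icc α β := by
  rcases (tsupport f).eq_empty_or_nonempty with he | hne
  · exact ⟨1, 1, one_pos, le_rfl, by simp [he]⟩
  · have hK : IsCompact (tsupport f) := hc
    obtain ⟨a, ha⟩ := hK.exists_isLeast hne
    obtain ⟨b, hb⟩ := hK.exists_isGreatest hne
    exact ⟨a, b, hpos ha.1, ha.2 hb.1, fun x hx => ⟨ha.2 hx, hb.2 hx⟩⟩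

lemma exists_abs_iteratedDeriv_le {f : ℝ → ℝ} (hf : ContDiff ℝ (⊤ : ℕ∞) f)
    (hc : HasCompactSupport f) (i : ℕ) :
    ∃ C, 0 ≤ C ∧ ∀ x, |iteratedDeriv i f x| ≤ C := by
  have h : HasCompactSupport (iteratedDeriv i f) :=
    hc.of_isClosed_subset isClosed_closure (tsupport_iteratedDeriv_subset f i)
  obtain ⟨C, hC⟩ := (hf.continuous_iteratedDeriv i (by exact_mod_cast le_top)
    ).bounded_above_of_compact_support h
  exact ⟨C, (norm_nonneg _).trans (hC 0), hC⟩

lemma exists_abs_iteratedDeriv_mul_comp_le {Ψ φ : ℝ → ℝ} (hΨ : ContDiff ℝ (⊤ : ℕ∞) Ψ)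
    (hΨc : HasCompactSupport Ψ) (hφ : ContDiff ℝ (⊤ : ℕ∞) φ) (hφc : HasCompactSupport φ)
    {K : ℝ} (hK : 0 < K) (p : ℕ) :
    ∃ D, 0 ≤ D ∧ ∀ u y x : ℝ, K ≤ u →
      |iteratedDeriv p (fun x => Ψ x * φ (u * (x - y))) x| ≤ D * u ^ p := by
  choose C hC0 hC using exists_abs_iteratedDeriv_le hΨ hΨc
  choose E hE0 hE using exists_abs_iteratedDeriv_le hφ hφc
  refine ⟨∑ i ∈ Finset.range (p + 1), p.choose i * C i * (E (p - i) * K⁻¹ ^ i),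
    Finset.sum_nonneg fun i _ => by have := hC0 i; have := hE0 (p - i); positivity, ?_⟩
  intro u y x hu
  have hu0 : 0 < u := hK.trans_le hu
  have hg : ContDiff ℝ (⊤ : ℕ∞) fun x => φ (u * (x - y)) := by fun_prop
  have hd (n : ℕ) : iteratedDeriv n (fun x => φ (u * (x - y))) x =
      u ^ n * iteratedDeriv n φ (u * (x - y)) := by
    rw [iteratedDeriv_comp_sub_const n (fun x => φ (u * x)) y,
      iteratedDeriv_comp_const_mul (hφ.of_le (by exact_mod_cast le_top))]
  rw [iteratedDeriv_fun_mul (hΨ.of_le (by exact_mod_cast le_top)).contDiffAt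
    (hg.of_le (by exact_mod_cast le_top)).contDiffAt, Finset.sum_mul]
  refine (Finset.abs_sum_le_sum_abs _ _).trans (Finset.sum_le_sum fun i hi => ?_)
  have hip : i ≤ p := Nat.lt_succ_iff.1 (Finset.mem_range.1 hi)
  have hpow : u ^ (p - i) ≤ K⁻¹ ^ i * u ^ p := by
    rw [inv_pow, ← div_eq_inv_mul, le_div_iff₀ (by positivity)]
    calc u ^ (p - i) * K ^ i ≤ u ^ (p - i) * u ^ i := by gcongr
      _ = u ^ p := by rw [← pow_add, Nat.sub_add_cancel hip]
  rw [hd, abs_mul, abs_mul, abs_mul, Nat.abs_cast, abs_of_pos (pow_pos hu0 _)]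
  have := hC0 i
  have := hE0 (p - i)
  calc (p.choose i : ℝ) * |iteratedDeriv i Ψ x| *
        (u ^ (p - i) * |iteratedDeriv (p - i) φ (u * (x - y))|)
      ≤ p.choose i * C i * (K⁻¹ ^ i * u ^ p * E (p - i)) := by
        gcongr
        · exact hC i x
        · exact hE _ _
    _ = _ := by ring

lemma exists_inner_mellin_le {Ψ φ : ℝ → ℝ} (hΨ : ContDiff ℝ (⊤ : ℕ∞) Ψ)
    (hΨc : HasCompactSupport Ψ) (hΨpos : tsupport Ψ ⊆ Set.Ioi 0)
    (hφ : ContDiff ℝ (⊤ : ℕ∞) φ) (hφc : HasCompactSupport φ)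
    {K : ℝ} (hK : 0 < K) (A : ℝ) (p : ℕ) :
    ∃ C, 0 ≤ C ∧ ∀ (s : ℂ) (u y : ℝ), |s.re| ≤ A → K ≤ u →
      u * (|s.im| ^ p * ‖∫ x in Set.Ioi (0 : ℝ),
        ((Ψ x * φ (u * (x - y)) : ℝ) : ℂ) * (x : ℂ) ^ (s - 1)‖) ≤ C * u ^ p := by
  obtain ⟨D, hD0, hD⟩ := exists_abs_iteratedDeriv_mul_comp_le hΨ hΨc hφ hφc hK p
  obtain ⟨α, β, hα, hαβ, hsupp⟩ := exists_tsupport_subset_Icc hΨc hΨpos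
  obtain ⟨M, hM0, hM⟩ := exists_rpow_le (β := β) hα (A + p + 1)
  obtain ⟨B, hB0, hB⟩ : ∃ B : ℝ, 0 < B ∧ tsupport φ ⊆ Metric.closedBall 0 B :=
    hφc.isCompact.isBounded.subset_closedBall_lt 0 0
  refine ⟨2 * D * M * B, by positivity, fun s u y hs hu => ?_⟩
  have hu0 : 0 < u := hK.trans_le hu
  set f : ℝ → ℝ := fun x => Ψ x * φ (u * (x - y))
  have hf : ContDiff ℝ (⊤ : ℕ∞) f := by fun_prop
  have hfΨ : tsupport f ⊆ tsupport Ψ := tsupport_mul_subset_left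
  have hfc : HasCompactSupport f := hΨc.mul_right
  have hfφ : tsupport f ⊆ Metric.closedBall y (B / u) := by
    refine closure_minimal (fun x hx => ?_) Metric.isClosed_closedBall
    have h1 : u * (x - y) ∈ tsupport φ := subset_tsupport _ (right_ne_zero_of_mul hx)
    have h2 := hB h1
    rw [mem_closedBall_zero_iff, Real.norm_eq_abs, abs_mul, abs_of_pos hu0] at h2
    rw [Metric.mem_closedBall, Real.dist_eq, le_div_iff₀ hu0]
    linarith
  have hsub : tsupport f ⊆ Set.Ioi 0 := hfΨ.trans hΨpos
  have hint := abs_im_pow_mul_norm_integral_mul_cpow_le p hf hfc hsub s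
  have hbound : ‖∫ x in Set.Ioi (0 : ℝ), ((iteratedDeriv p f x : ℝ) : ℂ) * (x : ℂ) ^ (s + p - 1)‖ ≤
      D * u ^ p * M * (2 * (B / u)) := by
    rw [setIntegral_eq_integral_of_forall_compl_eq_zero,
      ← setIntegral_eq_integral_of_forall_compl_eq_zero (s := Metric.closedBall y (B / u))]
    · refine (norm_setIntegral_le_of_norm_le_const (C := D * u ^ p * M)
        measure_closedBall_lt_top fun x _ => ?_).trans_eq ?_
      · by_cases hx : x ∈ tsupport f
        · have hxI := hsupp (hfΨ hx)
          rw [norm_mul, norm_cpow_eq_rpow_re_of_pos (hα.trans_le hxI.1), norm_real]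
          have := hD u y x hu
          have h3 := hM x hxI (s + p - 1).re (by
            simp only [sub_re, add_re, natCast_re, one_re]
            rw [abs_le] at hs ⊢
            have : (0 : ℝ) ≤ p := p.cast_nonneg
            constructor <;> linarith)
          have h4 := hα.trans_le hxI.1
          exact mul_le_mul this h3 (by positivity) (by positivity)
        · rw [image_eq_zero_of_notMem_tsupport
            fun h => hx (tsupport_iteratedDeriv_subset f p h)]
          simp only [ofReal_zero, zero_mul, norm_zero]
          positivity
      · rw [Real.volume_real_closedBall (by positivity)]
    · intro x hx
      rw [image_eq_zero_of_notMem_tsupport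
        fun h => hx (hfφ (tsupport_iteratedDeriv_subset f p h))]
      simp
    · intro x hx
      rw [image_eq_zero_of_notMem_tsupport
        fun h => hx (hsub (tsupport_iteratedDeriv_subset f p h))]
      simp
  calc u * (|s.im| ^ p * ‖∫ x in Set.Ioi (0 : ℝ), (f x : ℂ) * (x : ℂ) ^ (s - 1)‖)
      ≤ u * (D * u ^ p * M * (2 * (B / u))) := 
        mul_le_mul_of_nonneg_left (hint.trans hbound) hu0.le
    _ = _ := by field_simp

lemma comp_abs_eq_add_neg {Φ : ℝ → ℝ} (hpos : tsupport Φ ⊆ Set.Ioi 0) (z : ℝ) :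
    Φ |z| = Φ z + Φ (-z) := by
  rcases le_total 0 z with h | h
  · rw [abs_of_nonneg h, eq_zero_of_nonpos_of_tsupport hpos (neg_nonpos.2 h), add_zero]
  · rw [abs_of_nonpos h, eq_zero_of_nonpos_of_tsupport hpos h, zero_add]

lemma contDiff_comp_abs {Φ : ℝ → ℝ} (hΦ : ContDiff ℝ (⊤ : ℕ∞) Φ)
    (hpos : tsupport Φ ⊆ Set.Ioi 0) : ContDiff ℝ (⊤ : ℕ∞) fun z => Φ |z| := by
  simp_rw [comp_abs_eq_add_neg hpos]
  fun_prop

lemma hasCompactSupport_comp_abs {Φ : ℝ → ℝ} (hc : HasCompactSupport Φ)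
    (hpos : tsupport Φ ⊆ Set.Ioi 0) : HasCompactSupport fun z => Φ |z| := by
  simp_rw [comp_abs_eq_add_neg hpos]
  exact hc.add (hc.comp_homeomorph (Homeomorph.neg ℝ))

lemma Wfun_eq_mul_comp_abs (Φ Ψ : ℝ → ℝ) {u : ℝ} (hu : 0 ≤ u) (x y : ℝ) :
    Wfun Φ Ψ x y u = Ψ x * (Ψ y * Φ |u * (y - x)|) := by
  rw [Wfun, abs_mul, abs_of_nonneg hu, abs_sub_comm, mul_assoc]

lemma exists_W2Tilde_le {Φ Ψ : ℝ → ℝ} (hΦ : ContDiff ℝ (⊤ : ℕ∞) Φ)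
    (hΦc : HasCompactSupport Φ) (hΦpos : tsupport Φ ⊆ Set.Ioi 0)
    (hΨ : ContDiff ℝ (⊤ : ℕ∞) Ψ) (hΨc : HasCompactSupport Ψ)
    (hΨpos : tsupport Ψ ⊆ Set.Ioi 0) {K : ℝ} (hK : 0 < K) (A : ℝ) (p : ℕ) :
    ∃ C, 0 ≤ C ∧ ∀ (s₁ s₂ : ℂ) (u : ℝ), |s₁.re| ≤ A → |s₂.re| ≤ A → K ≤ u →
      u * (|s₂.im| ^ p * ‖W2Tilde Φ Ψ s₁ s₂ u‖) ≤ C * u ^ p := by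
  obtain ⟨C, hC0, hC⟩ := exists_inner_mellin_le hΨ hΨc hΨpos (contDiff_comp_abs hΦ hΦpos)
    (hasCompactSupport_comp_abs hΦc hΦpos) hK A p
  obtain ⟨α, β, hα, hαβ, hsupp⟩ := exists_tsupport_subset_Icc hΨc hΨpos
  obtain ⟨M, hM0, hM⟩ := exists_rpow_le (β := β) hα (A + 1)
  obtain ⟨E, hE⟩ := hΨ.continuous.bounded_above_of_compact_support hΨc
  have hE0 : 0 ≤ E := (norm_nonneg _).trans (hE 0)
  have hβα : 0 ≤ β - α := sub_nonneg.2 hαβ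
  refine ⟨E * M * C * (β - α), by positivity, fun s₁ s₂ u hs₁ hs₂ hu => ?_⟩
  have hu0 : 0 < u := hK.trans_le hu
  set J : ℝ → ℂ := fun x => ∫ y in Set.Ioi (0 : ℝ),
    ((Ψ y * Φ |u * (y - x)| : ℝ) : ℂ) * (y : ℂ) ^ (s₂ - 1) with hJ
  have hW : W2Tilde Φ Ψ s₁ s₂ u =
      ∫ x in Set.Icc α β, ((Ψ x : ℂ) * (x : ℂ) ^ (s₁ - 1)) * J x := by
    have hout (x : ℝ) (hx : x ∉ tsupport Ψ) : (Ψ x : ℂ) * (x : ℂ) ^ (s₁ - 1) * J x = 0 := by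
      rw [image_eq_zero_of_notMem_tsupport hx]
      simp
    rw [setIntegral_eq_integral_of_forall_compl_eq_zero fun x hx => hout x fun h => hx (hsupp h),
      ← setIntegral_eq_integral_of_forall_compl_eq_zero fun x hx => hout x fun h => hx (hΨpos h),
      W2Tilde]
    congr 1 with x
    rw [hJ, ← integral_const_mul]
    congr 1 with y
    rw [Wfun_eq_mul_comp_abs Φ Ψ hu0.le]
    push_cast
    ring
  have hconst : u * (|s₂.im| ^ p * ‖W2Tilde Φ Ψ s₁ s₂ u‖) =
      ‖∫ x in Set.Icc α β, ((u * |s₂.im| ^ p : ℝ) : ℂ) *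
        (((Ψ x : ℂ) * (x : ℂ) ^ (s₁ - 1)) * J x)‖ := by
    rw [hW, integral_const_mul, norm_mul, norm_real, Real.norm_of_nonneg (by positivity)]
    ring
  rw [hconst]
  refine (norm_setIntegral_le_of_norm_le_const (C := E * M * (C * u ^ p))
    measure_Icc_lt_top fun x hx => ?_).trans_eq ?_
  · have hx0 : 0 < x := hα.trans_le hx.1
    rw [norm_mul, norm_mul, norm_mul, norm_cpow_eq_rpow_re_of_pos hx0, norm_real, norm_real,
      Real.norm_of_nonneg (by positivity : 0 ≤ u * |s₂.im| ^ p)]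
    have h1 := hM x hx (s₁ - 1).re (by
      rw [sub_re, one_re]
      exact (abs_sub _ _).trans (by simpa using hs₁))
    calc u * |s₂.im| ^ p * (‖Ψ x‖ * x ^ (s₁ - 1).re * ‖J x‖)
        = ‖Ψ x‖ * x ^ (s₁ - 1).re * (u * (|s₂.im| ^ p * ‖J x‖)) := by ring
      _ ≤ E * M * (C * u ^ p) := by
        have h2 := hC s₂ u x hs₂ hu
        have h3 := hE x
        have h4 := Real.rpow_nonneg hx0.le (s₁ - 1).re
        exact mul_le_mul (mul_le_mul h3 h1 h4 hE0) h2 (by positivity) (by positivity)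
  · rw [Real.volume_real_Icc_of_le hαβ]
    ring

lemma W2Tilde_swap {Φ Ψ : ℝ → ℝ} (hΦ : Continuous Φ) (hΦc : HasCompactSupport Φ)
    (hΨ : Continuous Ψ) (hΨc : HasCompactSupport Ψ) (hΨpos : tsupport Ψ ⊆ Set.Ioi 0)
    (s₁ s₂ : ℂ) (u : ℝ) : W2Tilde Φ Ψ s₁ s₂ u = W2Tilde Φ Ψ s₂ s₁ u := by
  obtain ⟨E, hE⟩ := hΦ.bounded_above_of_compact_support hΦc
  have h1 := (integrable_ofReal_mul_cpow hΨ hΨc hΨpos (s₁ - 1)).restrict (s := Set.Ioi 0)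
  have h2 := (integrable_ofReal_mul_cpow hΨ hΨc hΨpos (s₂ - 1)).restrict (s := Set.Ioi 0)
  have hcont : Continuous fun z : ℝ × ℝ => ((Φ (u * |z.1 - z.2|) : ℝ) : ℂ) := by fun_prop
  have hint := (h1.mul_prod h2).bdd_mul (c := E) hcont.aestronglyMeasurable
    (Filter.Eventually.of_forall fun z => by simpa using hE (u * |z.1 - z.2|))
  rw [W2Tilde, integral_integral_swap, W2Tilde]
  · congr 1 with x
    congr 1 with y
    rw [Wfun, Wfun, abs_sub_comm]
    push_cast
    ring
  · refine hint.congr (Filter.Eventually.of_forall fun z => ?_)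
    simp only [Function.uncurry, Wfun]
    push_cast
    ring

lemma exists_W2Tilde_eq_zero {Φ Ψ : ℝ → ℝ} (hΦc : HasCompactSupport Φ)
    (hΦpos : tsupport Φ ⊆ Set.Ioi 0) (hΨc : HasCompactSupport Ψ)
    (hΨpos : tsupport Ψ ⊆ Set.Ioi 0) :
    ∃ K : ℝ, 0 < K ∧ ∀ s₁ s₂ : ℂ, ∀ u : ℝ, 0 ≤ u → u < K → W2Tilde Φ Ψ s₁ s₂ u = 0 := by
  obtain ⟨a, b, ha, -, hab⟩ := exists_tsupport_subset_Icc hΦc hΦpos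
  obtain ⟨α, β, hα, hαβ, hsupp⟩ := exists_tsupport_subset_Icc hΨc hΨpos
  have hβ : 0 < β := hα.trans_le hαβ
  refine ⟨a / β, by positivity, fun s₁ s₂ u hu huK => ?_⟩
  have hW (x y : ℝ) : Wfun Φ Ψ x y u = 0 := by
    by_contra h
    have hΦ0 := right_ne_zero_of_mul h
    have hΨ0 := left_ne_zero_of_mul h
    have hx := hsupp (subset_tsupport _ (left_ne_zero_of_mul hΨ0))
    have hy := hsupp (subset_tsupport _ (right_ne_zero_of_mul hΨ0))
    have hz := (hab (subset_tsupport _ hΦ0)).1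
    have hxy : |x - y| ≤ β := abs_le.2 ⟨by linarith [hx.1, hy.2], by linarith [hx.2, hy.1]⟩
    rw [lt_div_iff₀ hβ] at huK
    linarith [mul_le_mul_of_nonneg_left hxy hu]
  simp [W2Tilde, hW]

/-- (i) decay estimate for `W̃₂`, and (ii) vanishing of `W̃₂` for
small `u`. -/
theorem W2Tilde_decay_and_vanishing (Φ Ψ : ℝ → ℝ)
    (hΦsmooth : ContDiff ℝ (⊤ : ℕ∞) Φ) (hΦsupp : HasCompactSupport Φ)
    (hΦpos : ∀ x, 0 ≤ Φ x) (hΦsupp' : tsupport Φ ⊆ Set.Ioi 0)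
    (hΨsmooth : ContDiff ℝ (⊤ : ℕ∞) Ψ) (hΨsupp : HasCompactSupport Ψ)
    (hΨpos : ∀ x, 0 ≤ Ψ x) (hΨsupp' : tsupport Ψ ⊆ Set.Ioi 0)
    (A : ℝ) (hA : 0 < A) :
    (∀ p : ℕ, 1 ≤ p → ∃ C : ℝ, ∀ s₁ s₂ : ℂ, ∀ u : ℝ,
      -A ≤ s₁.re → s₁.re ≤ A → -A ≤ s₂.re → s₂.re ≤ A → 0 ≤ u →
      ‖W2Tilde Φ Ψ s₁ s₂ u‖ ≤ C * u^(p - 1) / (1 + max |s₁.im| |s₂.im| ^ p)) ∧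
    (∃ K : ℝ, 0 < K ∧ ∀ s₁ s₂ : ℂ, ∀ u : ℝ, 0 ≤ u → u < K →
      W2Tilde Φ Ψ s₁ s₂ u = 0) := by
  obtain ⟨K, hK, hKzero⟩ := exists_W2Tilde_eq_zero hΦsupp hΦsupp' hΨsupp hΨsupp'
  refine ⟨fun p hp => ?_, K, hK, hKzero⟩
  obtain ⟨C, hC0, hC⟩ := exists_W2Tilde_le hΦsmooth hΦsupp hΦsupp' hΨsmooth hΨsupp hΨsupp' hK A p
  obtain ⟨D, hD0, hD⟩ := exists_W2Tilde_le hΦsmooth hΦsupp hΦsupp' hΨsmooth hΨsupp hΨsupp' hK A 0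
  refine ⟨D * K⁻¹ ^ p + C, fun s₁ s₂ u hs₁ hs₁' hs₂ hs₂' hu => ?_⟩
  rcases lt_or_ge u K with huK | huK
  · rw [hKzero s₁ s₂ u hu huK, norm_zero]
    positivity
  have hu0 : 0 < u := hK.trans_le huK
  have h1 : |s₁.re| ≤ A := abs_le.2 ⟨hs₁, hs₁'⟩
  have h2 : |s₂.re| ≤ A := abs_le.2 ⟨hs₂, hs₂'⟩
  have hmax : u * (max |s₁.im| |s₂.im| ^ p * ‖W2Tilde Φ Ψ s₁ s₂ u‖) ≤ C * u ^ p := by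
    rcases max_choice |s₁.im| |s₂.im| with h | h <;> rw [h]
    · rw [W2Tilde_swap hΦsmooth.continuous hΦsupp hΨsmooth.continuous hΨsupp hΨsupp']
      exact hC s₂ s₁ u h2 h1 huK
    · exact hC s₁ s₂ u h1 h2 huK
  have hone : u * ‖W2Tilde Φ Ψ s₁ s₂ u‖ ≤ D * K⁻¹ ^ p * u ^ p := by
    have h0 := hD s₁ s₂ u h1 h2 huK
    simp only [pow_zero, one_mul, mul_one] at h0
    have : 1 ≤ K⁻¹ ^ p * u ^ p := by
      rw [← mul_pow, ← div_eq_inv_mul]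
      exact one_le_pow₀ ((one_le_div hK).2 huK)
    calc _ ≤ D * 1 := by simpa using h0
      _ ≤ D * (K⁻¹ ^ p * u ^ p) := by gcongr
      _ = _ := by ring
  rw [le_div_iff₀ (by positivity)]
  refine le_of_mul_le_mul_left ?_ hu0
  have hup : u * u ^ (p - 1) = u ^ p := by rw [← pow_succ', Nat.sub_add_cancel hp]
  calc u * (‖W2Tilde Φ Ψ s₁ s₂ u‖ * (1 + max |s₁.im| |s₂.im| ^ p))
      = u * ‖W2Tilde Φ Ψ s₁ s₂ u‖ +
        u * (max |s₁.im| |s₂.im| ^ p * ‖W2Tilde Φ Ψ s₁ s₂ u‖) := by ring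
    _ ≤ D * K⁻¹ ^ p * u ^ p + C * u ^ p := add_le_add hone hmax
    _ = u * ((D * K⁻¹ ^ p + C) * u ^ (p - 1)) := by rw [← hup]; ring
end

section
/- Fix an integer k ≥ 2, a constant C > 0, and ε > 0. There is a constant C_ε such that uniformly for all real X ≥ 2 and all positive integers q with q ≤ X^C, one has | Σ_{n ≥ 1, gcd(n,q)=1} d_k(n)² Ψ(n/X)² − (a_k(q)/(k²−1)!) · X (log X)^{k²−1} | ≤ C_ε · X (log X)^{k²−2+ε}. -/
open MeasureTheory

/-- `d_k(n)`: number of ordered k-tuples of positive integers with product n. -/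
noncomputable def dk (k n : ℕ) : ℕ :=
  Nat.card {f : Fin k → ℕ // (∀ i, 0 < f i) ∧ ∏ i, f i = n}

/-- `𝔞_p`. -/
noncomputable def frakA (k p : ℕ) : ℝ :=
  ∑' ℓ : ℕ, (((k + ℓ - 1).choose (k - 1) : ℝ))^2 / (p : ℝ)^ℓ

/-- `a_k`. -/
noncomputable def aCst (k : ℕ) : ℝ :=
  ∏' p : Nat.Primes, ((1 - 1/((p : ℕ) : ℝ))^(k^2) * frakA k p)

/-- `a_k(q)`. -/
noncomputable def aCstQ (k q : ℕ) : ℝ :=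
  aCst k * ∏ p ∈ q.primeFactors, (frakA k p)⁻¹

open ArithmeticFunction in
lemma arith_mul_prime_pow {R : Type*} [CommSemiring R] (f g : ArithmeticFunction R) {p : ℕ}
    (hp : p.Prime) (j : ℕ) :
    (f * g) (p ^ j) = ∑ i ∈ Finset.range (j + 1), f (p ^ i) * g (p ^ (j - i)) := by
  rw [mul_apply, Nat.sum_divisorsAntidiagonal (f := fun a b => f a * g b),
    Nat.sum_divisors_prime_pow hp]
  refine Finset.sum_congr rfl fun i hi => ?_
  rw [Nat.pow_div (by simpa [Nat.lt_succ_iff] using hi) hp.pos]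

open ArithmeticFunction in
lemma card_finMulAntidiag_eq_zeta_pow (k n : ℕ) :
    (Nat.finMulAntidiag k n).card = ((zeta : ArithmeticFunction ℕ) ^ k) n := by
  induction k generalizing n with
  | zero =>
    rcases eq_or_ne n 1 with rfl | hn
    · simp [Nat.finMulAntidiag_one]
    · simp [Nat.finMulAntidiag_zero_left hn, hn]
  | succ k ih =>
    rw [pow_succ', mul_apply]
    have : (Nat.finMulAntidiag (k + 1) n).card =
        (n.divisorsAntidiagonal.sigma fun x => Nat.finMulAntidiag k x.2).card := by
      refine Finset.card_bij' (fun f _ => ⟨(f 0, ∏ i : Fin k, f i.succ), fun i => f i.succ⟩)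
        (fun y _ => Fin.cons y.1.1 y.2) ?_ ?_ ?_ ?_
      · intro f hf
        simp only [Nat.mem_finMulAntidiag, Fin.prod_univ_succ] at hf
        obtain ⟨h1, h2⟩ := hf
        simp only [Finset.mem_sigma, Nat.mem_divisorsAntidiagonal, Nat.mem_finMulAntidiag, true_and]
        refine ⟨⟨h1, h2⟩, ?_⟩
        rintro h
        simp [h] at h1
        exact h2 h1.symm
      · rintro ⟨⟨a, b⟩, f⟩ hf
        simp only [Finset.mem_sigma, Nat.mem_divisorsAntidiagonal, Nat.mem_finMulAntidiag] at hf
        simp only [Nat.mem_finMulAntidiag, Fin.prod_univ_succ, Fin.cons_zero, Fin.cons_succ]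
        exact ⟨by rw [hf.2.1]; exact hf.1.1, hf.1.2⟩
      · intro f hf
        ext i
        refine Fin.cases ?_ (fun i => ?_) i <;> simp
      · rintro ⟨⟨a, b⟩, f⟩ hf
        simp only [Finset.mem_sigma, Nat.mem_divisorsAntidiagonal, Nat.mem_finMulAntidiag] at hf
        simp [← hf.2.1]
    rw [this, Finset.card_sigma]
    refine Finset.sum_congr rfl fun x hx => ?_
    have := Nat.mem_divisorsAntidiagonal.1 hx
    rw [zeta_apply_ne (by rintro h; simp [h] at this; exact this.2 this.1.symm), one_mul, ih]

open ArithmeticFunction in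
lemma dk_eq_zeta_pow (k n : ℕ) : dk k n = ((zeta : ArithmeticFunction ℕ) ^ k) n := by
  rw [← card_finMulAntidiag_eq_zeta_pow, dk]
  rcases Nat.eq_zero_or_pos n with rfl | hn
  · rw [Nat.finMulAntidiag_zero_right, Finset.card_empty]
    have : IsEmpty {f : Fin k → ℕ // (∀ i, 0 < f i) ∧ ∏ i, f i = 0} := by
      refine ⟨fun f => ?_⟩
      exact (Finset.prod_pos fun i _ => f.2.1 i).ne' f.2.2
    simp
  · refine Nat.subtype_card _ fun f => ?_
    simp only [Nat.mem_finMulAntidiag]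
    refine ⟨fun h => ⟨fun i => Nat.pos_of_ne_zero fun hi => h.2 ?_, h.1⟩, fun h => ⟨h.2, hn.ne'⟩⟩
    rw [← h.1, Finset.prod_eq_zero (Finset.mem_univ i) hi]

open ArithmeticFunction in
lemma zeta_pow_prime_pow (k : ℕ) {p : ℕ} (hp : p.Prime) (l : ℕ) :
    ((zeta : ArithmeticFunction ℕ) ^ (k + 1)) (p ^ l) = (k + l).choose k := by
  induction k generalizing l with
  | zero => simp [hp.ne_zero]
  | succ k ih =>
    rw [pow_succ, arith_mul_prime_pow _ _ hp]
    have : ∀ i ∈ Finset.range (l + 1), ((zeta : ArithmeticFunction ℕ) ^ (k + 1)) (p ^ i) *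
        zeta (p ^ (l - i)) = (i + k).choose k := fun i _ => by
      rw [ih, zeta_apply_ne (pow_ne_zero _ hp.ne_zero), mul_one, add_comm]
    rw [Finset.sum_congr rfl this, Nat.sum_range_add_choose]
    congr 1; ring

lemma dk_prime_pow {k : ℕ} (hk : 1 ≤ k) {p : ℕ} (hp : p.Prime) (l : ℕ) :
    dk k (p ^ l) = (k + l - 1).choose (k - 1) := by
  obtain ⟨k, rfl⟩ := Nat.exists_eq_add_of_le' hk
  rw [dk_eq_zeta_pow, zeta_pow_prime_pow k hp]
  congr 1; omega

lemma dk_zero_right (k : ℕ) : dk k 0 = 0 := by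
  rw [dk_eq_zeta_pow, ArithmeticFunction.map_zero]

/-- The arithmetic function `n ↦ d_k(n)²` restricted to integers coprime to `q`. -/
noncomputable def coprimeDkSq (k q : ℕ) : ArithmeticFunction ℝ :=
  ⟨fun n => if Nat.gcd n q = 1 then (dk k n : ℝ) ^ 2 else 0, by simp [dk_zero_right]⟩

lemma coprimeDkSq_apply (k q n : ℕ) :
    coprimeDkSq k q n = if Nat.gcd n q = 1 then (dk k n : ℝ) ^ 2 else 0 := rfl

open ArithmeticFunction in
lemma isMultiplicative_coprimeDkSq (k q : ℕ) : (coprimeDkSq k q).IsMultiplicative := by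
  have hz : ((zeta : ArithmeticFunction ℕ) ^ k).IsMultiplicative :=
    isMultiplicative_zeta.pow
  refine ⟨?_, fun {m n} hmn => ?_⟩
  · simp [coprimeDkSq_apply, dk_eq_zeta_pow, hz.map_one]
  · simp only [coprimeDkSq_apply, dk_eq_zeta_pow, hz.map_mul_of_coprime hmn]
    have : Nat.gcd (m * n) q = 1 ↔ Nat.gcd m q = 1 ∧ Nat.gcd n q = 1 := Nat.coprime_mul_iff_left
    by_cases h1 : Nat.gcd m q = 1 <;> by_cases h2 : Nat.gcd n q = 1 <;>
      simp [this, h1, h2, mul_pow]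

/-- The Dirichlet quotient of `coprimeDkSq k q` by the `k²`-fold divisor function. -/
noncomputable def dkSqQuotient (k q : ℕ) : ArithmeticFunction ℝ :=
  coprimeDkSq k q * ((ArithmeticFunction.moebius : ArithmeticFunction ℤ) :
    ArithmeticFunction ℝ) ^ (k ^ 2)

open ArithmeticFunction in
lemma isMultiplicative_dkSqQuotient (k q : ℕ) : (dkSqQuotient k q).IsMultiplicative :=
  (isMultiplicative_coprimeDkSq k q).mul isMultiplicative_moebius.intCast.pow

open ArithmeticFunction in
lemma zeta_pow_mul_dkSqQuotient (k q : ℕ) :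
    ((zeta : ArithmeticFunction ℕ) : ArithmeticFunction ℝ) ^ (k ^ 2) * dkSqQuotient k q =
      coprimeDkSq k q := by
  rw [dkSqQuotient, mul_left_comm, ← mul_pow, coe_zeta_mul_coe_moebius, one_pow, mul_one]

section LocalFactors

open ArithmeticFunction

variable {p : ℕ} {f g : ArithmeticFunction ℝ} {x : ℝ}

lemma abs_arith_mul_prime_pow_le (hp : p.Prime) (f g : ArithmeticFunction ℝ) (hx : 0 ≤ x) (j : ℕ) :
    |(f * g) (p ^ j)| * x ^ j ≤ ∑ i ∈ Finset.range (j + 1),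
      (|f (p ^ i)| * x ^ i) * (|g (p ^ (j - i))| * x ^ (j - i)) := by
  rw [arith_mul_prime_pow _ _ hp]
  grw [Finset.abs_sum_le_sum_abs]
  rw [Finset.sum_mul]
  refine Finset.sum_le_sum fun i hi => le_of_eq ?_
  have : x ^ j = x ^ i * x ^ (j - i) := by
    rw [← pow_add]; congr 1; have := Finset.mem_range.1 hi; omega
  rw [abs_mul, this]; ring

lemma hasSum_abs_cauchy
    (hf : Summable fun j => |f (p ^ j)| * x ^ j) (hg : Summable fun j => |g (p ^ j)| * x ^ j) :
    HasSum (fun j => ∑ i ∈ Finset.range (j + 1),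
      (|f (p ^ i)| * x ^ i) * (|g (p ^ (j - i))| * x ^ (j - i)))
      ((∑' j, |f (p ^ j)| * x ^ j) * ∑' j, |g (p ^ j)| * x ^ j) :=
  hasSum_sum_range_mul_of_summable_norm (f := fun j => |f (p ^ j)| * x ^ j)
    (g := fun j => |g (p ^ j)| * x ^ j) hf.norm hg.norm

lemma summable_local_mul (hp : p.Prime) (hx : 0 ≤ x)
    (hf : Summable fun j => |f (p ^ j)| * x ^ j) (hg : Summable fun j => |g (p ^ j)| * x ^ j) :
    Summable fun j => |(f * g) (p ^ j)| * x ^ j :=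
  .of_nonneg_of_le (fun _ => by positivity) (abs_arith_mul_prime_pow_le hp f g hx)
    (hasSum_abs_cauchy hf hg).summable

lemma tsum_abs_local_mul_le (hp : p.Prime) (hx : 0 ≤ x)
    (hf : Summable fun j => |f (p ^ j)| * x ^ j) (hg : Summable fun j => |g (p ^ j)| * x ^ j) :
    ∑' j, |(f * g) (p ^ j)| * x ^ j ≤
      (∑' j, |f (p ^ j)| * x ^ j) * ∑' j, |g (p ^ j)| * x ^ j := by
  rw [← (hasSum_abs_cauchy hf hg).tsum_eq]
  exact (summable_local_mul hp hx hf hg).tsum_le_tsum (abs_arith_mul_prime_pow_le hp f g hx)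
    (hasSum_abs_cauchy hf hg).summable

lemma tsum_local_mul (hp : p.Prime) (hx : 0 ≤ x)
    (hf : Summable fun j => |f (p ^ j)| * x ^ j) (hg : Summable fun j => |g (p ^ j)| * x ^ j) :
    ∑' j, (f * g) (p ^ j) * x ^ j =
      (∑' j, f (p ^ j) * x ^ j) * ∑' j, g (p ^ j) * x ^ j := by
  have aux : ∀ h : ArithmeticFunction ℝ, (Summable fun j => |h (p ^ j)| * x ^ j) →
      Summable fun j => ‖h (p ^ j) * x ^ j‖ := fun h hh => hh.congr fun j => by
    rw [norm_mul, Real.norm_eq_abs, Real.norm_of_nonneg (pow_nonneg hx j)]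
  rw [tsum_mul_tsum_eq_tsum_sum_range_of_summable_norm (aux f hf) (aux g hg)]
  refine tsum_congr fun j => ?_
  rw [arith_mul_prime_pow _ _ hp, Finset.sum_mul]
  refine Finset.sum_congr rfl fun i hi => ?_
  have : x ^ j = x ^ i * x ^ (j - i) := by
    rw [← pow_add]; congr 1; have := Finset.mem_range.1 hi; omega
  rw [this]; ring

lemma local_moebius (hp : p.Prime) (j : ℕ) :
    ((moebius : ArithmeticFunction ℤ) : ArithmeticFunction ℝ) (p ^ j) =
      if j = 0 then 1 else if j = 1 then -1 else 0 := by
  rcases eq_or_ne j 0 with rfl | hj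
  · simp
  · rw [intCoe_apply, moebius_apply_prime_pow hp hj]
    simp [hj]

lemma local_moebius_pow (hp : p.Prime) (hx : 0 ≤ x) (K : ℕ) :
    (Summable fun j =>
      |(((moebius : ArithmeticFunction ℤ) : ArithmeticFunction ℝ) ^ K) (p ^ j)| * x ^ j) ∧
    ∑' j, |(((moebius : ArithmeticFunction ℤ) : ArithmeticFunction ℝ) ^ K) (p ^ j)| * x ^ j ≤
      (1 + x) ^ K ∧
    ∑' j, (((moebius : ArithmeticFunction ℤ) : ArithmeticFunction ℝ) ^ K) (p ^ j) * x ^ j =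
      (1 - x) ^ K := by
  induction K with
  | zero =>
    have h0 : ∀ j ∉ ({0} : Finset ℕ), (1 : ArithmeticFunction ℝ) (p ^ j) = 0 := fun j hj =>
      one_apply_ne (by simpa [hp.ne_one] using hj)
    simp only [pow_zero]
    refine ⟨summable_of_ne_finset_zero (s := {0}) fun j hj => by simp [h0 j hj], ?_, ?_⟩
    · rw [tsum_eq_sum (s := {0}) fun j hj => by simp [h0 j hj]]
      simp
    · rw [tsum_eq_sum (s := {0}) fun j hj => by simp [h0 j hj]]
      simp
  | succ K ih =>
    have h0 : ∀ j ∉ Finset.range 2,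
        ((moebius : ArithmeticFunction ℤ) : ArithmeticFunction ℝ) (p ^ j) = 0 := fun j hj => by
      rw [local_moebius hp, if_neg, if_neg] <;> simp at hj <;> omega
    have hs : Summable fun j =>
        |((moebius : ArithmeticFunction ℤ) : ArithmeticFunction ℝ) (p ^ j)| * x ^ j :=
      summable_of_ne_finset_zero (s := Finset.range 2) fun j hj => by simp [h0 j hj]
    obtain ⟨i1, i2, i3⟩ := ih
    rw [pow_succ]
    refine ⟨summable_local_mul hp hx i1 hs, ?_, ?_⟩
    · refine (tsum_abs_local_mul_le hp hx i1 hs).trans ?_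
      rw [pow_succ]
      refine mul_le_mul i2 (le_of_eq ?_) (tsum_nonneg fun _ => by positivity) (by positivity)
      rw [tsum_eq_sum (s := Finset.range 2) fun j hj => by simp [h0 j hj]]
      simp [Finset.sum_range_succ, local_moebius hp, -intCoe_apply]
    · rw [tsum_local_mul hp hx i1 hs, i3, pow_succ]
      congr 1
      rw [tsum_eq_sum (s := Finset.range 2) fun j hj => by simp [h0 j hj]]
      simp [Finset.sum_range_succ, local_moebius hp, -intCoe_apply, sub_eq_add_neg]

lemma summable_choose_sq_mul_pow (k : ℕ) (hx : 0 ≤ x) (hx1 : x < 1) :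
    Summable fun j : ℕ => (((k + j - 1).choose (k - 1) : ℝ)) ^ 2 * x ^ j := by
  have h1 := summable_pow_mul_geometric_of_norm_lt_one (2 * (k - 1)) (r := x)
    (by rwa [Real.norm_of_nonneg hx])
  have h2 := summable_geometric_of_lt_one hx hx1
  refine .of_nonneg_of_le (fun _ => by positivity) (fun j => ?_)
    ((h1.add h2).mul_left ((k + 1 : ℝ) ^ (2 * (k - 1)) * 2 ^ (2 * (k - 1))))
  have h3 : (((k + j - 1).choose (k - 1) : ℝ)) ≤ ((k + j : ℕ) : ℝ) ^ (k - 1) := by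
    exact_mod_cast (Nat.choose_le_pow _ _).trans (Nat.pow_le_pow_left (by omega) _)
  have h4 : ((k + j : ℕ) : ℝ) ≤ (k + 1) * (j + 1) := by
    push_cast; nlinarith [(Nat.cast_nonneg k : (0:ℝ) ≤ k), (Nat.cast_nonneg j : (0:ℝ) ≤ j)]
  have h5 : ((j : ℝ) + 1) ^ (2 * (k - 1)) ≤ 2 ^ (2 * (k - 1)) * ((j : ℝ) ^ (2 * (k - 1)) + 1) := by
    rcases Nat.eq_zero_or_pos j with rfl | hj
    · simp only [CharP.cast_eq_zero, zero_add, one_pow]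
      have : (1:ℝ) ≤ 2 ^ (2 * (k - 1)) := one_le_pow₀ (by norm_num)
      nlinarith [pow_nonneg (le_refl (0:ℝ)) (2 * (k - 1))]
    · have : (1 : ℝ) ≤ j := by exact_mod_cast hj
      calc ((j : ℝ) + 1) ^ (2 * (k - 1)) ≤ (2 * j) ^ (2 * (k - 1)) := by gcongr; linarith
        _ ≤ _ := by rw [mul_pow]; gcongr; linarith
  calc (((k + j - 1).choose (k - 1) : ℝ)) ^ 2 * x ^ j
      ≤ ((((k + 1) * (j + 1)) ^ (k - 1)) ^ 2) * x ^ j := by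
        gcongr; exact h3.trans (by gcongr)
    _ = (k + 1 : ℝ) ^ (2 * (k - 1)) * ((j : ℝ) + 1) ^ (2 * (k - 1)) * x ^ j := by
        rw [← pow_mul, mul_pow, mul_comm (k - 1) 2]
    _ ≤ (k + 1 : ℝ) ^ (2 * (k - 1)) * (2 ^ (2 * (k - 1)) * ((j : ℝ) ^ (2 * (k - 1)) + 1)) * x ^ j := by
        gcongr
    _ = _ := by ring

lemma moebius_pow_apply_prime (hp : p.Prime) (K : ℕ) :
    (((moebius : ArithmeticFunction ℤ) : ArithmeticFunction ℝ) ^ K) p = -K := by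
  induction K with
  | zero => simp [one_apply_ne hp.ne_one]
  | succ K ih =>
    have h1 : (((moebius : ArithmeticFunction ℤ) : ArithmeticFunction ℝ) ^ K) 1 = 1 :=
      (isMultiplicative_moebius.intCast (R := ℝ)).pow.map_one
    have := arith_mul_prime_pow (((moebius : ArithmeticFunction ℤ) : ArithmeticFunction ℝ) ^ K)
      ((moebius : ArithmeticFunction ℤ) : ArithmeticFunction ℝ) hp 1
    rw [pow_one] at this
    rw [pow_succ, this]
    simp [Finset.sum_range_succ, ih, h1, moebius_apply_prime hp]

lemma coprimeDkSq_prime_pow_of_dvd {k q : ℕ} (hp : p.Prime) (hpq : p ∣ q) {j : ℕ} (hj : j ≠ 0) :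
    coprimeDkSq k q (p ^ j) = 0 := by
  rw [coprimeDkSq_apply, if_neg]
  intro h
  have : p ∣ Nat.gcd (p ^ j) q := Nat.dvd_gcd (dvd_pow_self p hj) hpq
  rw [h] at this
  exact hp.one_lt.ne' (Nat.dvd_one.1 this)

lemma coprimeDkSq_prime_pow_of_not_dvd {k q : ℕ} (hk : 1 ≤ k) (hp : p.Prime) (hpq : ¬ p ∣ q)
    (j : ℕ) : coprimeDkSq k q (p ^ j) = (((k + j - 1).choose (k - 1) : ℝ)) ^ 2 := by
  rw [coprimeDkSq_apply, if_pos, dk_prime_pow hk hp]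
  exact Nat.Coprime.pow_left j ((Nat.Prime.coprime_iff_not_dvd hp).2 hpq)

lemma summable_local_coprimeDkSq {k : ℕ} (hk : 1 ≤ k) (q : ℕ) (hp : p.Prime) (hx : 0 ≤ x)
    (hx1 : x < 1) : Summable fun j => |coprimeDkSq k q (p ^ j)| * x ^ j := by
  by_cases hpq : p ∣ q
  · refine summable_of_ne_finset_zero (s := {0}) fun j hj => ?_
    rw [coprimeDkSq_prime_pow_of_dvd hp hpq (by simpa using hj), abs_zero, zero_mul]
  · refine (summable_choose_sq_mul_pow k hx hx1).congr fun j => ?_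
    rw [coprimeDkSq_prime_pow_of_not_dvd hk hp hpq, abs_sq]

lemma summable_local_dkSqQuotient {k : ℕ} (hk : 1 ≤ k) (q : ℕ) (hp : p.Prime) (hx : 0 ≤ x)
    (hx1 : x < 1) : Summable fun j => |dkSqQuotient k q (p ^ j)| * x ^ j :=
  summable_local_mul hp hx (summable_local_coprimeDkSq hk q hp hx hx1)
    (local_moebius_pow hp hx _).1

lemma tsum_abs_local_of_dvd {k q : ℕ} (hk : 1 ≤ k) (hp : p.Prime) (hpq : p ∣ q) (hx : 0 ≤ x)
    (hx1 : x < 1) : ∑' j, |dkSqQuotient k q (p ^ j)| * x ^ j ≤ (1 + x) ^ (k ^ 2) := by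
  refine (tsum_abs_local_mul_le hp hx (summable_local_coprimeDkSq hk q hp hx hx1)
    (local_moebius_pow hp hx _).1).trans ?_
  rw [tsum_eq_single 0 fun j hj => by
    rw [coprimeDkSq_prime_pow_of_dvd hp hpq hj, abs_zero, zero_mul]]
  simpa [(isMultiplicative_coprimeDkSq k q).map_one] using (local_moebius_pow hp hx (k ^ 2)).2.1

lemma tsum_local_of_dvd {k q : ℕ} (hk : 1 ≤ k) (hp : p.Prime) (hpq : p ∣ q) (hx : 0 ≤ x)
    (hx1 : x < 1) : ∑' j, dkSqQuotient k q (p ^ j) * x ^ j = (1 - x) ^ (k ^ 2) := by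
  rw [dkSqQuotient, tsum_local_mul hp hx (summable_local_coprimeDkSq hk q hp hx hx1)
    (local_moebius_pow hp hx _).1, tsum_eq_single 0 fun j hj => by
    rw [coprimeDkSq_prime_pow_of_dvd hp hpq hj, zero_mul], (local_moebius_pow hp hx (k ^ 2)).2.2]
  simp [(isMultiplicative_coprimeDkSq k q).map_one]

lemma tsum_local_of_not_dvd {k q : ℕ} (hk : 1 ≤ k) (hp : p.Prime) (hpq : ¬ p ∣ q) (hx : 0 ≤ x)
    (hx1 : x < 1) : ∑' j, dkSqQuotient k q (p ^ j) * x ^ j =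
      (1 - x) ^ (k ^ 2) * ∑' j : ℕ, (((k + j - 1).choose (k - 1) : ℝ)) ^ 2 * x ^ j := by
  rw [dkSqQuotient, tsum_local_mul hp hx (summable_local_coprimeDkSq hk q hp hx hx1)
    (local_moebius_pow hp hx _).1, (local_moebius_pow hp hx (k ^ 2)).2.2, mul_comm]
  simp_rw [coprimeDkSq_prime_pow_of_not_dvd hk hp hpq]

lemma dkSqQuotient_prime_of_not_dvd {k q : ℕ} (hk : 1 ≤ k) (hp : p.Prime) (hpq : ¬ p ∣ q) :
    dkSqQuotient k q p = 0 := by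
  have := arith_mul_prime_pow (coprimeDkSq k q)
    (((moebius : ArithmeticFunction ℤ) : ArithmeticFunction ℝ) ^ (k ^ 2)) hp 1
  rw [pow_one] at this
  have h1 : (((moebius : ArithmeticFunction ℤ) : ArithmeticFunction ℝ) ^ (k ^ 2)) 1 = 1 :=
    (isMultiplicative_moebius.intCast (R := ℝ)).pow.map_one
  have h2 := coprimeDkSq_prime_pow_of_not_dvd hk hp hpq 1
  have h3 : k.choose (k - 1) = k := by
    obtain ⟨k, rfl⟩ := Nat.exists_eq_add_of_le' hk
    simp
  rw [pow_one, Nat.add_sub_cancel, h3] at h2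
  rw [dkSqQuotient, this]
  simp only [Finset.sum_range_succ, Finset.range_zero, Finset.sum_empty, pow_zero, tsub_zero,
    pow_one, zero_add, tsub_self, h1, h2, moebius_pow_apply_prime hp,
    (isMultiplicative_coprimeDkSq k q).map_one]
  push_cast; ring

lemma exists_tsum_abs_local_of_not_dvd {k : ℕ} (hk : 1 ≤ k) {r : ℝ} (hr : 0 < r) (hr1 : r < 1) :
    ∃ M : ℝ, 0 ≤ M ∧ ∀ p q : ℕ, p.Prime → ¬ p ∣ q → ∀ x : ℝ, 0 ≤ x → x ≤ r →
      ∑' j, |dkSqQuotient k q (p ^ j)| * x ^ j ≤ 1 + M * x ^ 2 := by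
  refine ⟨(∑' j : ℕ, (((k + j - 1).choose (k - 1) : ℝ)) ^ 2 * r ^ j) * (1 + r) ^ (k ^ 2) / r ^ 2,
    ?_, fun p q hp hpq x hx hxr => ?_⟩
  · have : 0 ≤ ∑' j : ℕ, (((k + j - 1).choose (k - 1) : ℝ)) ^ 2 * r ^ j :=
      tsum_nonneg fun _ => by positivity
    positivity
  have hM : ∑' j, |dkSqQuotient k q (p ^ j)| * r ^ j ≤
      (∑' j : ℕ, (((k + j - 1).choose (k - 1) : ℝ)) ^ 2 * r ^ j) * (1 + r) ^ (k ^ 2) := by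
    refine (tsum_abs_local_mul_le hp hr.le (summable_local_coprimeDkSq hk q hp hr.le hr1)
      (local_moebius_pow hp hr.le _).1).trans ?_
    simp_rw [coprimeDkSq_prime_pow_of_not_dvd hk hp hpq, abs_sq]
    exact mul_le_mul_of_nonneg_left (local_moebius_pow hp hr.le (k ^ 2)).2.1
      (tsum_nonneg fun _ => by positivity)
  have hs := summable_local_dkSqQuotient hk q hp hx (hxr.trans_lt hr1)
  have hsr := summable_local_dkSqQuotient hk q hp hr.le hr1
  rw [← hs.sum_add_tsum_nat_add 2]
  have h2 : ∑ j ∈ Finset.range 2, |dkSqQuotient k q (p ^ j)| * x ^ j = 1 := by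
    simp [Finset.sum_range_succ, dkSqQuotient_prime_of_not_dvd hk hp hpq,
      (isMultiplicative_dkSqQuotient k q).map_one]
  rw [h2]
  gcongr
  have hs2 := (summable_nat_add_iff 2).2 hsr
  calc ∑' j, |dkSqQuotient k q (p ^ (j + 2))| * x ^ (j + 2)
      ≤ ∑' j, (x ^ 2 / r ^ 2) * (|dkSqQuotient k q (p ^ (j + 2))| * r ^ (j + 2)) := by
        refine ((summable_nat_add_iff 2).2 hs).tsum_le_tsum (fun j => ?_) (hs2.mul_left _)
        have : x ^ (j + 2) ≤ x ^ 2 / r ^ 2 * r ^ (j + 2) := by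
          have e : x ^ 2 / r ^ 2 * r ^ (j + 2) = x ^ j * x ^ 2 + (r ^ j - x ^ j) * x ^ 2 := by
            field_simp; ring
          rw [e, pow_add]
          have : x ^ j ≤ r ^ j := pow_le_pow_left₀ hx hxr j
          nlinarith [mul_nonneg (sub_nonneg.2 this) (sq_nonneg x)]
        calc _ ≤ |dkSqQuotient k q (p ^ (j + 2))| * (x ^ 2 / r ^ 2 * r ^ (j + 2)) := by gcongr
          _ = _ := by ring
    _ = (x ^ 2 / r ^ 2) * ∑' j, (|dkSqQuotient k q (p ^ (j + 2))| * r ^ (j + 2)) := tsum_mul_left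
    _ ≤ (x ^ 2 / r ^ 2) * ∑' j, (|dkSqQuotient k q (p ^ j)| * r ^ j) := by
        refine mul_le_mul_of_nonneg_left ?_ (by positivity)
        rw [← hsr.sum_add_tsum_nat_add 2]
        exact le_add_of_nonneg_left (Finset.sum_nonneg fun _ _ => by positivity)
    _ ≤ (x ^ 2 / r ^ 2) * ((∑' j : ℕ, (((k + j - 1).choose (k - 1) : ℝ)) ^ 2 * r ^ j) *
        (1 + r) ^ (k ^ 2)) := by gcongr
    _ = _ := by ring

end LocalFactors

section PrimeSums

open ArithmeticFunction Finset

lemma sum_vonMangoldt_div_le (N : ℕ) :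
    ∑ d ∈ Ioc 0 N, vonMangoldt d / d ≤ 2 * Real.log N := by
  rcases Nat.eq_zero_or_pos N with rfl | hN
  · simp
  have hN' : (0 : ℝ) < N := by exact_mod_cast hN
  have h1 := sum_Ioc_mul_zeta_eq_sum vonMangoldt N
  rw [vonMangoldt_mul_zeta] at h1
  have h2 : ∑ n ∈ Ioc 0 N, ArithmeticFunction.log n ≤ N * Real.log N := by
    calc ∑ n ∈ Ioc 0 N, ArithmeticFunction.log n ≤ ∑ n ∈ Ioc 0 N, Real.log N := by
          refine sum_le_sum fun n hn => ?_
          rw [mem_Ioc] at hn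
          rw [log_apply]
          exact Real.log_le_log (by exact_mod_cast hn.1) (by exact_mod_cast hn.2)
      _ = _ := by simp
  have h3 : ∑ d ∈ Ioc 0 N, vonMangoldt d * (N / (2 * d)) ≤ N * Real.log N := by
    refine (sum_le_sum fun d hd => ?_).trans (h1 ▸ h2)
    refine mul_le_mul_of_nonneg_left ?_ vonMangoldt_nonneg
    rw [mem_Ioc] at hd
    have hd0 : (0 : ℝ) < d := by exact_mod_cast hd.1
    have h4 : N < (N / d + 1) * d := by
      have := Nat.lt_div_mul_add hd.1 (a := N)
      nlinarith
    have h5 : 1 ≤ N / d := Nat.div_pos hd.2 hd.1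
    have h6 : N ≤ N / d * (2 * d) := by nlinarith
    rw [div_le_iff₀ (by positivity)]
    exact_mod_cast h6
  have h7 : ∑ d ∈ Ioc 0 N, vonMangoldt d * ((N : ℝ) / (2 * d)) =
      (N / 2) * ∑ d ∈ Ioc 0 N, vonMangoldt d / d := by
    rw [mul_sum]
    refine sum_congr rfl fun d hd => ?_
    ring
  rw [h7] at h3
  nlinarith

lemma sum_primes_log_div_le {S : Finset ℕ} (hS : ∀ p ∈ S, p.Prime) {Y : ℝ} (hY : 1 ≤ Y)
    (hSY : ∀ p ∈ S, (p : ℝ) ≤ Y) : ∑ p ∈ S, Real.log p / p ≤ 2 * Real.log Y := by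
  calc ∑ p ∈ S, Real.log p / p = ∑ p ∈ S, vonMangoldt p / p :=
        sum_congr rfl fun p hp => by rw [vonMangoldt_apply_prime (hS p hp)]
    _ ≤ ∑ d ∈ Ioc 0 ⌊Y⌋₊, vonMangoldt d / d := by
        refine sum_le_sum_of_subset_of_nonneg (fun p hp => ?_) fun _ _ _ =>
          div_nonneg vonMangoldt_nonneg (Nat.cast_nonneg _)
        rw [mem_Ioc]
        exact ⟨(hS p hp).pos, Nat.le_floor (hSY p hp)⟩
    _ ≤ 2 * Real.log ⌊Y⌋₊ := sum_vonMangoldt_div_le _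
    _ ≤ _ := by
        have : 0 < ⌊Y⌋₊ := Nat.floor_pos.2 hY
        gcongr
        exact Nat.floor_le (by linarith)

lemma sum_primeFactors_log_le {q : ℕ} (hq : 1 ≤ q) :
    ∑ p ∈ q.primeFactors, Real.log p ≤ Real.log q := by
  rw [← Real.log_prod (fun p hp => by exact_mod_cast (Nat.prime_of_mem_primeFactors hp).ne_zero)]
  have h := Nat.le_of_dvd hq (Nat.prod_primeFactors_dvd q)
  have h2 : ∏ p ∈ q.primeFactors, (p : ℝ) ≤ q := by
    have := (Nat.cast_le (α := ℝ)).2 h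
    rwa [Nat.cast_prod] at this
  refine Real.log_le_log (prod_pos fun p hp => ?_) h2
  exact_mod_cast (Nat.prime_of_mem_primeFactors hp).pos

lemma sum_primes_inv_le {S : Finset ℕ} (hS : ∀ p ∈ S, p.Prime) {Y : ℝ} (hY : 1 ≤ Y)
    (hSY : ∀ p ∈ S, (p : ℝ) ≤ Y) {T : ℝ} (hT : 1 < T) :
    ∑ p ∈ S, 1 / (p : ℝ) ≤ T + 2 * Real.log Y / Real.log T := by
  have hlT : 0 < Real.log T := Real.log_pos hT
  rw [← sum_filter_add_sum_filter_not S (fun p : ℕ => (p : ℝ) ≤ T)]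
  refine add_le_add ?_ ?_
  · calc ∑ p ∈ S with ((p : ℕ) : ℝ) ≤ T, 1 / (p : ℝ) ≤ ∑ p ∈ S with ((p : ℕ) : ℝ) ≤ T, 1 := by
          refine sum_le_sum fun p hp => ?_
          have := (hS p (mem_filter.1 hp).1).one_lt
          rw [div_le_one (by exact_mod_cast (by omega : 0 < p))]
          exact_mod_cast this.le
      _ ≤ ∑ p ∈ Ioc 0 ⌊T⌋₊, (1 : ℝ) := by
          refine sum_le_sum_of_subset_of_nonneg (fun p hp => ?_) fun _ _ _ => zero_le_one
          rw [mem_filter] at hp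
          exact mem_Ioc.2 ⟨(hS p hp.1).pos, Nat.le_floor hp.2⟩
      _ = ⌊T⌋₊ := by simp
      _ ≤ T := Nat.floor_le (by linarith)
  · rw [le_div_iff₀ hlT, sum_mul]
    refine le_trans (sum_le_sum fun p hp => ?_) (sum_primes_log_div_le (S := {p ∈ S | ¬ (p : ℝ) ≤ T})
      (fun p hp => hS p (mem_filter.1 hp).1) hY (fun p hp => hSY p (mem_filter.1 hp).1))
    rw [mem_filter, not_le] at hp
    rw [div_mul_eq_mul_div, one_mul]
    gcongr
    exact hp.2.le

lemma sum_primeFactors_rpow_le {C η : ℝ} (hη : 0 < η) :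
    ∃ A : ℝ, 0 ≤ A ∧ ∀ Y : ℝ, Real.exp 4 ≤ Y → ∀ q : ℕ, 1 ≤ q → Real.log q ≤ C * Y →
      ∑ p ∈ q.primeFactors, (p : ℝ) ^ (-(1 - 1 / Real.log Y)) ≤ η * Real.log Y + A := by
  set T := Real.exp (2 * Real.exp 1 / η) with hT
  have hT1 : 1 < T := by rw [hT, Real.one_lt_exp_iff]; positivity
  refine ⟨Real.exp 1 * T + Real.exp 1 * |C|, by positivity, fun Y hY q hq hqC => ?_⟩
  have hY0 : 0 < Y := (Real.exp_pos 4).trans_le hY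
  have hlY : 4 ≤ Real.log Y := (Real.le_log_iff_exp_le hY0).2 hY
  have hY1 : 1 ≤ Y := by
    by_contra h
    have := Real.log_nonpos hY0.le (not_le.1 h).le
    linarith
  have hYe : Y ^ (1 / Real.log Y) = Real.exp 1 := by
    rw [Real.rpow_def_of_pos hY0, mul_one_div_cancel (by linarith)]
  rw [← sum_filter_add_sum_filter_not q.primeFactors (fun p : ℕ => (p : ℝ) ≤ Y)]
  have hprime : ∀ p ∈ q.primeFactors, p.Prime := fun p hp => Nat.prime_of_mem_primeFactors hp
  have e1 : ∑ p ∈ q.primeFactors with ((p : ℕ) : ℝ) ≤ Y, (p : ℝ) ^ (-(1 - 1 / Real.log Y)) ≤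
      Real.exp 1 * (T + 2 * Real.log Y / Real.log T) := by
    refine le_trans ?_ (mul_le_mul_of_nonneg_left (sum_primes_inv_le
      (S := {p ∈ q.primeFactors | ((p : ℕ) : ℝ) ≤ Y}) (fun p hp => hprime p (mem_filter.1 hp).1) hY1
      (fun p hp => (mem_filter.1 hp).2) hT1) (Real.exp_pos 1).le)
    rw [mul_sum]
    refine sum_le_sum fun p hp => ?_
    rw [mem_filter] at hp
    have hp0 : (0 : ℝ) < p := by exact_mod_cast (hprime p hp.1).pos
    rw [neg_sub, Real.rpow_sub hp0, Real.rpow_one, ← hYe, mul_one_div]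
    gcongr
    · exact hp.2
  have e2 : ∑ p ∈ q.primeFactors with ¬ ((p : ℕ) : ℝ) ≤ Y, (p : ℝ) ^ (-(1 - 1 / Real.log Y)) ≤
      Real.exp 1 * |C| := by
    calc ∑ p ∈ q.primeFactors with ¬ ((p : ℕ) : ℝ) ≤ Y, (p : ℝ) ^ (-(1 - 1 / Real.log Y))
        ≤ ∑ p ∈ q.primeFactors with ¬ ((p : ℕ) : ℝ) ≤ Y, (Real.exp 1 / Y) * Real.log p := by
          refine sum_le_sum fun p hp => ?_
          rw [mem_filter, not_le] at hp
          have hl : 1 ≤ Real.log p := by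
            have := Real.log_le_log hY0 hp.2.le
            linarith
          have h1 : (p : ℝ) ^ (-(1 - 1 / Real.log Y)) ≤ Real.exp 1 / Y := by
            have e : Y ^ (1 / Real.log Y) / Y = Y ^ (1 / Real.log Y - 1) := by
              rw [Real.rpow_sub hY0, Real.rpow_one]
            rw [← hYe, e, neg_sub]
            refine Real.rpow_le_rpow_of_nonpos hY0 hp.2.le ?_
            rw [sub_nonpos, div_le_one (by linarith)]
            linarith
          refine h1.trans (le_mul_of_one_le_right (by positivity) hl)
      _ ≤ ∑ p ∈ q.primeFactors, (Real.exp 1 / Y) * Real.log p := by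
          refine sum_le_sum_of_subset_of_nonneg (filter_subset _ _) fun p hp _ => ?_
          have := Real.log_natCast_nonneg p
          positivity
      _ = (Real.exp 1 / Y) * ∑ p ∈ q.primeFactors, Real.log p := by rw [mul_sum]
      _ ≤ (Real.exp 1 / Y) * (|C| * Y) := by
          gcongr
          refine (sum_primeFactors_log_le hq).trans (hqC.trans ?_)
          gcongr; exact le_abs_self C
      _ = _ := by field_simp
  have e3 : Real.exp 1 * (2 * Real.log Y / Real.log T) = η * Real.log Y := by
    rw [hT, Real.log_exp]
    have := Real.exp_pos 1
    field_simp
  nlinarith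

end PrimeSums

section Rankin

open ArithmeticFunction Finset

lemma exists_sum_abs_dkSqQuotient_rpow_le {k : ℕ} (hk : 1 ≤ k) :
    ∃ B : ℝ, 0 ≤ B ∧ ∀ q : ℕ, 1 ≤ q → ∀ σ : ℝ, 3 / 4 ≤ σ → ∀ N : ℕ,
      ∑ m ∈ range N, |dkSqQuotient k q m| * (m : ℝ) ^ (-σ) ≤
        B * Real.exp ((k : ℝ) ^ 2 * ∑ p ∈ q.primeFactors, (p : ℝ) ^ (-σ)) := by
  have hr : (0 : ℝ) < 2 ^ (-(3 / 4) : ℝ) := by positivity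
  have hr1 : (2 : ℝ) ^ (-(3 / 4) : ℝ) < 1 :=
    Real.rpow_lt_one_of_one_lt_of_neg (by norm_num) (by norm_num)
  obtain ⟨M, hM, hMp⟩ := exists_tsum_abs_local_of_not_dvd hk hr hr1
  have hsum32 : Summable fun n : ℕ => (n : ℝ) ^ (-(3 / 2) : ℝ) :=
    Real.summable_nat_rpow.2 (by norm_num)
  refine ⟨Real.exp (M * ∑' n : ℕ, (n : ℝ) ^ (-(3 / 2) : ℝ)), by positivity,
    fun q hq σ hσ N => ?_⟩
  set h : ℕ → ℝ := fun m => |dkSqQuotient k q m| * (m : ℝ) ^ (-σ) with hh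
  have hg := isMultiplicative_dkSqQuotient k q
  have h1 : h 1 = 1 := by simp [hh, hg.map_one]
  have hmul : ∀ {m n}, Nat.Coprime m n → h (m * n) = h m * h n := fun {m n} hmn => by
    simp only [hh, hg.map_mul_of_coprime hmn, abs_mul, Nat.cast_mul]
    rw [Real.mul_rpow (by positivity) (by positivity)]
    ring
  have hpow : ∀ p j : ℕ, h (p ^ j) = |dkSqQuotient k q (p ^ j)| * ((p : ℝ) ^ (-σ)) ^ j := by
    intro p j
    simp only [hh, Nat.cast_pow]
    rw [← Real.rpow_natCast, ← Real.rpow_natCast, ← Real.rpow_mul (by positivity),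
      ← Real.rpow_mul (by positivity), mul_comm (-σ)]
  have hh0 : ∀ m, 0 ≤ h m := fun m => by simp only [hh]; positivity
  have hxr : ∀ {p : ℕ}, p.Prime → (p : ℝ) ^ (-σ) ≤ 2 ^ (-(3 / 4) : ℝ) := fun {p} hp => by
    have hp2 : (2 : ℝ) ≤ p := by exact_mod_cast hp.two_le
    calc (p : ℝ) ^ (-σ) ≤ (p : ℝ) ^ (-(3 / 4) : ℝ) :=
          Real.rpow_le_rpow_of_exponent_le (by linarith) (by linarith)
      _ ≤ _ := Real.rpow_le_rpow_of_nonpos (by norm_num) hp2 (by norm_num)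
  have hx2 : ∀ {p : ℕ}, p.Prime → ((p : ℝ) ^ (-σ)) ^ 2 ≤ (p : ℝ) ^ (-(3 / 2) : ℝ) :=
    fun {p} hp => by
    have hp2 : (1 : ℝ) ≤ p := by exact_mod_cast hp.one_lt.le
    rw [← Real.rpow_natCast, ← Real.rpow_mul (by positivity)]
    exact Real.rpow_le_rpow_of_exponent_le hp2 (by push_cast; linarith)
  have hlocsum : ∀ {p : ℕ}, p.Prime → Summable fun j => ‖h (p ^ j)‖ := fun {p} hp => by
    refine (summable_local_dkSqQuotient hk q hp (x := (p : ℝ) ^ (-σ)) (by positivity)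
      ((hxr hp).trans_lt hr1)).congr fun j => ?_
    rw [Real.norm_of_nonneg (hh0 _), hpow]
  have hloc : ∀ {p : ℕ}, p.Prime → ∑' j, h (p ^ j) ≤ Real.exp (M * (p : ℝ) ^ (-(3 / 2) : ℝ) +
      if p ∣ q then (k : ℝ) ^ 2 * (p : ℝ) ^ (-σ) else 0) := fun {p} hp => by
    simp_rw [hpow]
    have hx0 : (0 : ℝ) ≤ (p : ℝ) ^ (-σ) := by positivity
    split_ifs with hpq
    · refine (tsum_abs_local_of_dvd hk hp hpq hx0 ((hxr hp).trans_lt hr1)).trans ?_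
      calc (1 + (p : ℝ) ^ (-σ)) ^ (k ^ 2) ≤ Real.exp ((p : ℝ) ^ (-σ)) ^ (k ^ 2) := by
            gcongr
            rw [add_comm]
            exact Real.add_one_le_exp _
        _ = Real.exp ((k : ℝ) ^ 2 * (p : ℝ) ^ (-σ)) := by rw [← Real.exp_nat_mul]; push_cast; rfl
        _ ≤ _ := by
          gcongr
          have : 0 ≤ M * (p : ℝ) ^ (-(3 / 2) : ℝ) := by positivity
          linarith
    · refine (hMp p q hp hpq _ hx0 (hxr hp)).trans ?_
      rw [add_zero, add_comm]
      refine (add_le_add_left (mul_le_mul_of_nonneg_left (hx2 hp) hM) 1).trans ?_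
      exact Real.add_one_le_exp _
  obtain ⟨hs, hprod⟩ :=
    EulerProduct.summable_and_hasSum_smoothNumbers_prod_primesBelow_tsum h1 hmul hlocsum N
  calc ∑ m ∈ range N, h m ≤ ∑' m : N.smoothNumbers, h m := by
        have hz : h 0 = 0 := by simp [hh]
        have e : ∑ m ∈ range N, h m = ∑ m ∈ range N with m ≠ 0, h m := by
          rw [sum_filter_of_ne]
          rintro m - hm rfl
          exact hm hz
        have hmem : ∀ m ∈ (range N).filter (· ≠ 0), m ∈ N.smoothNumbers := fun m hm => by
          rw [mem_filter, mem_range] at hm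
          exact Nat.mem_smoothNumbers_of_lt (Nat.pos_of_ne_zero hm.2) hm.1
        rw [e, ← sum_subtype_of_mem h hmem]
        exact hprod.summable.sum_le_tsum _ fun _ _ => hh0 _
    _ = ∏ p ∈ N.primesBelow, ∑' j, h (p ^ j) := hprod.tsum_eq
    _ ≤ ∏ p ∈ N.primesBelow, Real.exp (M * (p : ℝ) ^ (-(3 / 2) : ℝ) +
          if p ∣ q then (k : ℝ) ^ 2 * (p : ℝ) ^ (-σ) else 0) :=
        prod_le_prod (fun p _ => tsum_nonneg fun j => hh0 _)
          fun p hp => hloc (Nat.prime_of_mem_primesBelow hp)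
    _ = Real.exp (M * ∑ p ∈ N.primesBelow, (p : ℝ) ^ (-(3 / 2) : ℝ) +
          (k : ℝ) ^ 2 * ∑ p ∈ N.primesBelow with p ∣ q, (p : ℝ) ^ (-σ)) := by
        rw [← Real.exp_sum, sum_add_distrib, ← mul_sum, ← sum_filter, ← mul_sum]
    _ ≤ Real.exp (M * ∑' n : ℕ, (n : ℝ) ^ (-(3 / 2) : ℝ) +
          (k : ℝ) ^ 2 * ∑ p ∈ q.primeFactors, (p : ℝ) ^ (-σ)) := by
        gcongr
        · exact hsum32.sum_le_tsum _ fun _ _ => by positivity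
        · intro p hp
          rw [mem_filter] at hp
          exact Nat.mem_primeFactors.2 ⟨Nat.prime_of_mem_primesBelow hp.1, hp.2, by omega⟩
    _ = _ := Real.exp_add _ _

lemma exists_sum_abs_dkSqQuotient_le {k : ℕ} (hk : 1 ≤ k) (C : ℝ) {ε : ℝ} (hε : 0 < ε) :
    ∃ A : ℝ, 0 ≤ A ∧ ∀ Y : ℝ, Real.exp 4 ≤ Y → ∀ q : ℕ, 1 ≤ q → Real.log q ≤ C * Y → ∀ N : ℕ,
      ∑ m ∈ range N, |dkSqQuotient k q m| * ((1 + Real.log m) / m) ≤ A * Y ^ ε := by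
  obtain ⟨B, hB, hBq⟩ := exists_sum_abs_dkSqQuotient_rpow_le hk
  have hk0 : (0 : ℝ) < (k : ℝ) ^ 2 := by positivity
  obtain ⟨A, hA, hAq⟩ :=
    sum_primeFactors_rpow_le (C := C) (η := ε / 2 / (k : ℝ) ^ 2) (by positivity)
  refine ⟨2 / (ε / 2) * (B * Real.exp ((k : ℝ) ^ 2 * A)), by positivity,
    fun Y hY q hq hqC N => ?_⟩
  have hY0 : 0 < Y := (Real.exp_pos 4).trans_le hY
  have hlY : 4 ≤ Real.log Y := (Real.le_log_iff_exp_le hY0).2 hY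
  have hσ : 3 / 4 ≤ 1 - 1 / Real.log Y := by
    have : 1 / Real.log Y ≤ 1 / 4 := one_div_le_one_div_of_le (by norm_num) hlY
    linarith
  have hterm : ∀ m : ℕ, (1 + Real.log m) / m ≤
      (1 + Real.log Y) * (m : ℝ) ^ (-(1 - 1 / Real.log Y)) := fun m => by
    rcases Nat.eq_zero_or_pos m with rfl | hm
    · simp only [Nat.cast_zero, div_zero]; positivity
    have hm0 : (0 : ℝ) < m := by exact_mod_cast hm
    have hm1 : (1 : ℝ) ≤ m := by exact_mod_cast hm
    rw [neg_sub, Real.rpow_sub hm0, Real.rpow_one, ← mul_div_assoc, add_mul, one_mul]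
    gcongr
    · exact Real.one_le_rpow hm1 (by positivity)
    · have := Real.log_le_rpow_div hm0.le (ε := 1 / Real.log Y) (by positivity)
      rwa [div_div_eq_mul_div, div_one, mul_comm] at this
  calc ∑ m ∈ range N, |dkSqQuotient k q m| * ((1 + Real.log m) / m)
      ≤ ∑ m ∈ range N, |dkSqQuotient k q m| *
          ((1 + Real.log Y) * (m : ℝ) ^ (-(1 - 1 / Real.log Y))) := by
        gcongr with m hm
        exact hterm m
    _ = (1 + Real.log Y) *
          ∑ m ∈ range N, |dkSqQuotient k q m| * (m : ℝ) ^ (-(1 - 1 / Real.log Y)) := by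
        rw [mul_sum]
        exact sum_congr rfl fun _ _ => by ring
    _ ≤ (2 * (Y ^ (ε / 2) / (ε / 2))) *
          (B * Real.exp ((k : ℝ) ^ 2 * (ε / 2 / (k : ℝ) ^ 2 * Real.log Y + A))) := by
        have hl := Real.log_le_rpow_div hY0.le (ε := ε / 2) (by positivity)
        gcongr
        · linarith
        · refine (hBq q hq _ hσ N).trans ?_
          gcongr
          exact hAq Y hY q hq hqC
    _ = _ := by
        have e1 : Real.exp ((k : ℝ) ^ 2 * (ε / 2 / (k : ℝ) ^ 2 * Real.log Y + A)) =
            Y ^ (ε / 2) * Real.exp ((k : ℝ) ^ 2 * A) := by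
          rw [Real.rpow_def_of_pos hY0, ← Real.exp_add]
          congr 1
          field_simp
        have e2 : Y ^ ε = Y ^ (ε / 2) * Y ^ (ε / 2) := by
          rw [← Real.rpow_add hY0, add_halves]
        rw [e1, e2]
        ring

lemma summable_dkSqQuotient_div {k : ℕ} (hk : 1 ≤ k) {q : ℕ} (hq : 1 ≤ q) :
    Summable fun m : ℕ => |dkSqQuotient k q m| * ((1 + Real.log m) / m) := by
  obtain ⟨A, -, h⟩ := exists_sum_abs_dkSqQuotient_le hk 1 one_pos
  refine summable_of_sum_range_le (fun m => ?_)
    (h (max (Real.exp 4) (Real.log q)) (le_max_left _ _) q hq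
      (by rw [one_mul]; exact le_max_right _ _))
  have := Real.log_natCast_nonneg m
  positivity

lemma summable_abs_dkSqQuotient_div {k : ℕ} (hk : 1 ≤ k) {q : ℕ} (hq : 1 ≤ q) :
    Summable fun m : ℕ => ‖dkSqQuotient k q m / m‖ := by
  refine .of_nonneg_of_le (fun _ => norm_nonneg _) (fun m => ?_) (summable_dkSqQuotient_div hk hq)
  have := Real.log_natCast_nonneg m
  rw [norm_div, Real.norm_natCast, div_eq_mul_one_div, Real.norm_eq_abs]
  gcongr
  linarith

end Rankin

section EulerProduct

open ArithmeticFunction Finset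

lemma hasProd_dkSqQuotient_div {k : ℕ} (hk : 1 ≤ k) {q : ℕ} (hq : 1 ≤ q) :
    HasProd (fun p : Nat.Primes => (1 - 1 / ((p : ℕ) : ℝ)) ^ (k ^ 2) *
      if (p : ℕ) ∣ q then 1 else frakA k p) (∑' m : ℕ, dkSqQuotient k q m / m) := by
  have hg := isMultiplicative_dkSqQuotient k q
  have h := EulerProduct.eulerProduct_hasProd (f := fun m : ℕ => dkSqQuotient k q m / m)
    (by simp [hg.map_one])
    (fun {m n} hmn => by rw [hg.map_mul_of_coprime hmn, Nat.cast_mul, mul_div_mul_comm])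
    (summable_abs_dkSqQuotient_div hk hq) (by simp)
  refine HasProd.congr_fun h ?_
  intro p
  have hp0 : (1 : ℝ) < (p : ℕ) := by exact_mod_cast p.2.one_lt
  have hx0 : (0 : ℝ) ≤ 1 / (p : ℕ) := by positivity
  have hx1 : (1 : ℝ) / (p : ℕ) < 1 := (div_lt_one (by linarith)).2 hp0
  have e : ∀ j : ℕ, dkSqQuotient k q ((p : ℕ) ^ j) / (((p : ℕ) ^ j : ℕ) : ℝ) =
      dkSqQuotient k q ((p : ℕ) ^ j) * (1 / ((p : ℕ) : ℝ)) ^ j := fun j => by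
    rw [Nat.cast_pow, one_div_pow, mul_one_div]
  simp_rw [e]
  split_ifs with hpq
  · rw [tsum_local_of_dvd hk p.2 hpq hx0 hx1, mul_one]
  · rw [tsum_local_of_not_dvd hk p.2 hpq hx0 hx1, frakA]
    simp_rw [one_div_pow, mul_one_div]

lemma frakA_pos {k p : ℕ} (hp : p.Prime) : 0 < frakA k p := by
  have hp0 : (1 : ℝ) < p := by exact_mod_cast hp.one_lt
  have hs := summable_choose_sq_mul_pow k (x := 1 / (p : ℝ)) (by positivity)
    ((div_lt_one (by linarith)).2 hp0)
  simp_rw [one_div_pow, mul_one_div] at hs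
  refine hs.tsum_pos (fun _ => by positivity) 0 ?_
  simp

lemma tsum_dkSqQuotient_div {k : ℕ} (hk : 1 ≤ k) {q : ℕ} (hq : 1 ≤ q) :
    ∑' m : ℕ, dkSqQuotient k q m / m = aCstQ k q := by
  have h1 := hasProd_dkSqQuotient_div hk le_rfl
  have e1 : (fun p : Nat.Primes => (1 - 1 / ((p : ℕ) : ℝ)) ^ (k ^ 2) *
      if (p : ℕ) ∣ 1 then 1 else frakA k p) =
      fun p : Nat.Primes => (1 - 1 / ((p : ℕ) : ℝ)) ^ (k ^ 2) * frakA k p := by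
    funext p
    rw [if_neg fun h => p.2.one_lt.ne' (Nat.dvd_one.1 h)]
  rw [e1] at h1
  have h2 : HasProd (fun p : Nat.Primes => if (p : ℕ) ∣ q then (frakA k p)⁻¹ else 1)
      (∏ p ∈ q.primeFactors.subtype Nat.Prime, (frakA k (p : ℕ))⁻¹) := by
    have : ∏ p ∈ q.primeFactors.subtype Nat.Prime, (frakA k (p : ℕ))⁻¹ =
        ∏ p ∈ q.primeFactors.subtype Nat.Prime,
          if (p : ℕ) ∣ q then (frakA k (p : ℕ))⁻¹ else 1 :=
      prod_congr rfl fun p hp => by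
        rw [if_pos (Nat.dvd_of_mem_primeFactors (mem_subtype.1 hp))]
    rw [this]
    refine hasProd_prod_of_ne_finset_one fun p hp => if_neg fun hpq => hp ?_
    exact mem_subtype.2 (Nat.mem_primeFactors.2 ⟨p.2, hpq, by omega⟩)
  have h3 := h1.mul h2
  rw [prod_subtype_of_mem (fun p => (frakA k p)⁻¹) fun p hp => Nat.prime_of_mem_primeFactors hp]
    at h3
  rw [aCstQ, aCst, h1.tprod_eq]
  refine (hasProd_dkSqQuotient_div hk hq).unique ?_
  refine HasProd.congr_fun h3 ?_
  intro p
  split_ifs with hpq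
  · rw [mul_assoc, mul_inv_cancel₀ (frakA_pos p.2).ne']
  · rw [mul_one]

end EulerProduct

section SmoothDivisorSums

open ArithmeticFunction Finset

lemma sum_Ioc_mul_weighted (f g : ArithmeticFunction ℝ) (w : ℕ → ℝ) (N : ℕ) :
    ∑ n ∈ Ioc 0 N, (f * g) n * w n =
      ∑ m ∈ Ioc 0 N, f m * ∑ n ∈ Ioc 0 (N / m), g n * w (m * n) := by
  trans ∑ x ∈ Ioc 0 N ×ˢ Ioc 0 N with x.1 * x.2 ≤ N, f x.1 * (g x.2 * w (x.1 * x.2))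
  · simp only [mul_apply]
    trans ∑ n ∈ Ioc 0 N, ∑ x ∈ Ioc 0 N ×ˢ Ioc 0 N with x.1 * x.2 = n,
      f x.1 * (g x.2 * w (x.1 * x.2))
    · refine sum_congr rfl fun n hn => ?_
      simp only [mem_Ioc] at hn
      rw [Nat.divisorsAntidiagonal_eq_prod_filter_of_le hn.1.ne' hn.2, sum_mul]
      refine sum_congr rfl fun x hx => ?_
      rw [(mem_filter.1 hx).2, mul_assoc]
    · simp_rw [sum_filter]
      rw [sum_comm]
      exact sum_congr rfl fun _ _ => (by simp_all)
  · rw [sum_filter, sum_product]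
    refine sum_congr rfl fun n hn => ?_
    simp only [sum_ite, not_le, sum_const_zero, add_zero, mul_sum]
    congr
    ext
    simp only [mem_filter, mem_Ioc, and_assoc, and_congr_right_iff] at hn ⊢
    intro _
    constructor
    · intro ⟨_, h⟩
      grw [← h, Nat.mul_div_cancel_left _ (by lia)]
    · intro hm
      grw [hm]
      simp [Nat.mul_div_le, Nat.div_le_self]

lemma pow_succ_sub_pow_succ_bounds {a b : ℝ} (hb : 0 ≤ b) (hab : b ≤ a) (j : ℕ) :
    (j + 1) * b ^ j * (a - b) ≤ a ^ (j + 1) - b ^ (j + 1) ∧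
      a ^ (j + 1) - b ^ (j + 1) ≤ (j + 1) * a ^ j * (a - b) := by
  induction j with
  | zero => simp
  | succ j ih =>
    have ha : 0 ≤ a := hb.trans hab
    have hpow : b ^ (j + 1) ≤ a ^ (j + 1) := pow_le_pow_left₀ hb hab _
    have e : a ^ (j + 1 + 1) - b ^ (j + 1 + 1) =
        a * (a ^ (j + 1) - b ^ (j + 1)) + b ^ (j + 1) * (a - b) := by ring
    rw [e]
    push_cast
    have hd : 0 ≤ a - b := sub_nonneg.2 hab
    constructor
    · have h1 : b * ((j + 1) * b ^ j * (a - b)) ≤ a * (a ^ (j + 1) - b ^ (j + 1)) :=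
        mul_le_mul hab ih.1 (by positivity) ha
      calc _ = b * ((j + 1) * b ^ j * (a - b)) + b ^ (j + 1) * (a - b) := by ring
        _ ≤ _ := by gcongr
    · calc _ ≤ a * ((j + 1) * a ^ j * (a - b)) + a ^ (j + 1) * (a - b) := by
            gcongr
            exact ih.2
        _ = _ := by ring

lemma log_div_succ_step {y : ℝ} {n : ℕ} (hy : (n : ℝ) + 2 ≤ y) :
    0 ≤ Real.log (y / (n + 2)) ∧
      1 / ((n : ℝ) + 2) ≤ Real.log (y / (n + 1)) - Real.log (y / (n + 2)) ∧
      Real.log (y / (n + 1)) - Real.log (y / (n + 2)) ≤ 1 / ((n : ℝ) + 1) := by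
  have hn : (0 : ℝ) ≤ n := n.cast_nonneg
  have hy0 : 0 < y := by linarith
  have e : Real.log (y / (n + 1)) - Real.log (y / (n + 2)) = Real.log ((n + 2) / (n + 1)) := by
    rw [Real.log_div (by positivity) (by positivity), Real.log_div (by positivity) (by positivity),
      Real.log_div (by positivity) (by positivity)]
    ring
  refine ⟨Real.log_nonneg ((one_le_div (by positivity)).2 hy), ?_, ?_⟩
  · rw [e]
    have := Real.one_sub_inv_le_log_of_pos (x := ((n : ℝ) + 2) / (n + 1)) (by positivity)
    refine le_trans (le_of_eq ?_) this
    field_simp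
    ring
  · rw [e]
    have := Real.log_le_sub_one_of_pos (x := ((n : ℝ) + 2) / (n + 1)) (by positivity)
    refine this.trans (le_of_eq ?_)
    field_simp
    ring

lemma sum_log_pow_div_bounds (j : ℕ) (y : ℝ) (N : ℕ) (hN : (N : ℝ) + 1 ≤ y) :
    (Real.log y ^ (j + 1) - Real.log (y / (N + 1)) ^ (j + 1)) / (j + 1) ≤
        ∑ i ∈ range N, Real.log (y / (i + 1)) ^ j / (i + 1) ∧
      ∑ i ∈ range (N + 1), Real.log (y / (i + 1)) ^ j / (i + 1) ≤ Real.log y ^ j +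
        (Real.log y ^ (j + 1) - Real.log (y / (N + 1)) ^ (j + 1)) / (j + 1) := by
  induction N with
  | zero => simp
  | succ N ih =>
    push_cast at hN
    obtain ⟨ih1, ih2⟩ := ih (by linarith)
    obtain ⟨h0, h1, h2⟩ := log_div_succ_step (n := N) (y := y) (by linarith)
    have hN0 : (0 : ℝ) ≤ N := N.cast_nonneg
    have e : ((N + 1 : ℕ) : ℝ) + 1 = N + 2 := by push_cast; ring
    rw [e, sum_range_succ _ N, sum_range_succ _ (N + 1), e]
    set a := Real.log (y / (N + 1))
    set b := Real.log (y / (N + 2))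
    have hab : b ≤ a := by
      have : (0 : ℝ) ≤ 1 / (N + 2) := by positivity
      linarith
    have ha : 0 ≤ a := h0.trans hab
    obtain ⟨p1, p2⟩ := pow_succ_sub_pow_succ_bounds h0 hab j
    have hj : (0 : ℝ) < j + 1 := by positivity
    have u1 : (a ^ (j + 1) - b ^ (j + 1)) / (j + 1) ≤ a ^ j / (N + 1) := by
      rw [div_le_iff₀ hj]
      calc _ ≤ (j + 1) * a ^ j * (a - b) := p2
        _ ≤ (j + 1) * a ^ j * (1 / (N + 1)) := by gcongr
        _ = _ := by ring
    have u2 : b ^ j / (N + 2) ≤ (a ^ (j + 1) - b ^ (j + 1)) / (j + 1) := by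
      rw [le_div_iff₀ hj]
      calc b ^ j / (N + 2) * (j + 1) = (j + 1) * b ^ j * (1 / (N + 2)) := by ring
        _ ≤ (j + 1) * b ^ j * (a - b) := by gcongr
        _ ≤ _ := p1
    have e2 : (Real.log y ^ (j + 1) - b ^ (j + 1)) / (j + 1) =
        (Real.log y ^ (j + 1) - a ^ (j + 1)) / (j + 1) + (a ^ (j + 1) - b ^ (j + 1)) / (j + 1) := by
      ring
    rw [e2]
    constructor <;> linarith

lemma sum_Ioc_log_pow_div (j : ℕ) {y : ℝ} (hy : 1 ≤ y) :
    |∑ m ∈ Ioc 0 ⌊y⌋₊, Real.log (y / m) ^ j / m - Real.log y ^ (j + 1) / (j + 1)| ≤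
      (1 + Real.log y) ^ j := by
  have hy0 : 0 ≤ y := by linarith
  obtain ⟨N, hN⟩ := Nat.exists_eq_add_of_le' (Nat.floor_pos.2 hy)
  have hNy : (N : ℝ) + 1 ≤ y := by
    have := Nat.floor_le hy0
    rw [hN] at this
    exact_mod_cast this
  have hyN : y < N + 1 + 1 := by
    have := Nat.lt_floor_add_one y
    rw [hN] at this
    exact_mod_cast this
  have e : ∑ m ∈ Ioc 0 ⌊y⌋₊, Real.log (y / m) ^ j / m =
      ∑ i ∈ range (N + 1), Real.log (y / (i + 1)) ^ j / (i + 1) := by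
    rw [hN, ← Finset.Ico_add_one_add_one_eq_Ioc, sum_Ico_eq_sum_range]
    simp [add_comm]
  obtain ⟨h1, h2⟩ := sum_log_pow_div_bounds j y N hNy
  have hN0 : (0 : ℝ) ≤ N := N.cast_nonneg
  have hl : 0 ≤ Real.log y := Real.log_nonneg hy
  have ha0 : 0 ≤ Real.log (y / (N + 1)) := Real.log_nonneg ((one_le_div (by positivity)).2 hNy)
  have ha1 : Real.log (y / (N + 1)) ≤ 1 := by
    have h2 : y / (N + 1) ≤ 2 := by
      rw [div_le_iff₀ (by positivity)]
      linarith
    have := Real.log_le_sub_one_of_pos (x := y / (N + 1)) (by positivity)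
    linarith
  have hj : (0 : ℝ) < j + 1 := by positivity
  have hone : 1 ≤ (1 + Real.log y) ^ j := one_le_pow₀ (by linarith)
  have h3 : 0 ≤ Real.log (y / (N + 1)) ^ (j + 1) / (j + 1) := by positivity
  have h4 : Real.log (y / (N + 1)) ^ (j + 1) / (j + 1) ≤ 1 := by
    rw [div_le_one hj]
    have : Real.log (y / (N + 1)) ^ (j + 1) ≤ 1 := pow_le_one₀ ha0 ha1
    have : (0 : ℝ) ≤ j := j.cast_nonneg
    linarith
  have h5 : 0 ≤ Real.log (y / (N + 1)) ^ j / (N + 1) := by positivity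
  have h6 : Real.log y ^ j ≤ (1 + Real.log y) ^ j := by gcongr; linarith
  rw [sub_div] at h1 h2
  rw [e, abs_le]
  rw [sum_range_succ] at h2 ⊢
  constructor <;> linarith

/-- The sum of `f` over `n ≤ B * y` weighted by `F (n / y)`. -/
noncomputable def weightedSum (F : ℝ → ℝ) (B : ℝ) (f : ArithmeticFunction ℝ) (y : ℝ) : ℝ :=
  ∑ n ∈ Ioc 0 ⌊B * y⌋₊, f n * F (n / y)

lemma weightedSum_mul (F : ℝ → ℝ) (B : ℝ) (f g : ArithmeticFunction ℝ) (y : ℝ) :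
    weightedSum F B (f * g) y = ∑ m ∈ Ioc 0 ⌊B * y⌋₊, f m * weightedSum F B g (y / m) := by
  rw [weightedSum, sum_Ioc_mul_weighted f g fun n => F (n / y)]
  refine sum_congr rfl fun m hm => ?_
  have hm0 : (m : ℝ) ≠ 0 := by
    have := (mem_Ioc.1 hm).1
    positivity
  rw [weightedSum, ← mul_div_assoc, Nat.floor_div_natCast]
  congr 1
  refine sum_congr rfl fun n _ => ?_
  congr 2
  rw [div_div_eq_mul_div]
  push_cast
  ring

variable {F : ℝ → ℝ} {B : ℝ} {L : NNReal}

lemma abs_weight_le (hFs : Function.support F ⊆ Set.Ioc 0 B) (hFL : LipschitzWith L F)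
    (hB : 0 ≤ B) (u : ℝ) : |F u| ≤ L * B := by
  by_cases hu : F u = 0
  · rw [hu, abs_zero]; positivity
  · have h0 : F 0 = 0 := by
      by_contra h
      exact lt_irrefl _ (hFs h).1
    have h1 := hFs hu
    have := hFL.dist_le_mul u 0
    rw [Real.dist_eq, Real.dist_eq, h0, sub_zero, sub_zero, abs_of_pos h1.1] at this
    exact this.trans (by gcongr; exact h1.2)

lemma abs_weightedSum_le_of_le_one (hFs : Function.support F ⊆ Set.Ioc 0 B)
    (hFL : LipschitzWith L F) (hB : 0 ≤ B) (f : ArithmeticFunction ℝ) {y : ℝ} (hy : y ≤ 1) :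
    |weightedSum F B f y| ≤ L * B * ∑ n ∈ Ioc 0 ⌊B⌋₊, |f n| := by
  rw [weightedSum, mul_sum]
  grw [abs_sum_le_sum_abs]
  calc ∑ n ∈ Ioc 0 ⌊B * y⌋₊, |f n * F (n / y)| ≤ ∑ n ∈ Ioc 0 ⌊B * y⌋₊, L * B * |f n| := by
        refine sum_le_sum fun n _ => ?_
        rw [abs_mul, mul_comm]
        gcongr
        exact abs_weight_le hFs hFL hB _
    _ ≤ _ := by
        refine sum_le_sum_of_subset_of_nonneg (Ioc_subset_Ioc_right (Nat.floor_mono ?_))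
          fun _ _ _ => by positivity
        exact mul_le_of_le_one_right hB hy

lemma weightedSum_zeta_bound (hFs : Function.support F ⊆ Set.Ioc 0 B) (hFL : LipschitzWith L F)
    (hFi : ∫ u, F u = 1) (hB : 0 ≤ B) {y : ℝ} (hy : 1 ≤ y) :
    |weightedSum F B ((zeta : ArithmeticFunction ℕ) : ArithmeticFunction ℝ) y - y| ≤
      L * (B + 1) := by
  have hy0 : 0 < y := by linarith
  set N := ⌊B * y⌋₊ + 1 with hN
  have hNy : B * y < N := by
    rw [hN]; exact_mod_cast Nat.lt_floor_add_one (B * y)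
  have hNy' : (N : ℝ) ≤ B * y + 1 := by
    rw [hN]; push_cast; gcongr; exact Nat.floor_le (by positivity)
  have h0 : F 0 = 0 := by
    by_contra h
    exact lt_irrefl _ (hFs h).1
  have e1 : weightedSum F B ((zeta : ArithmeticFunction ℕ) : ArithmeticFunction ℝ) y =
      ∑ n ∈ range N, F (n / y) := by
    rw [weightedSum, hN, sum_range_succ', ← Finset.Ico_add_one_add_one_eq_Ioc,
      sum_Ico_eq_sum_range]
    simp [h0, add_comm, natCoe_apply]
  have hcont : Continuous fun t : ℝ => F (t / y) := hFL.continuous.comp (by fun_prop)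
  have e2 : y = ∑ n ∈ range N, ∫ t in (n : ℝ)..((n + 1 : ℕ) : ℝ), F (t / y) := by
    rw [intervalIntegral.sum_integral_adjacent_intervals fun n _ =>
      hcont.intervalIntegrable _ _, intervalIntegral.integral_eq_integral_of_support_subset,
      MeasureTheory.Measure.integral_comp_div, hFi, abs_of_pos hy0, smul_eq_mul, mul_one]
    intro t ht
    have := hFs ht
    rw [Set.mem_Ioc, div_le_iff₀ hy0] at this
    have h1 : 0 < t := by
      have := mul_pos this.1 hy0
      rwa [div_mul_cancel₀ _ hy0.ne'] at this
    exact ⟨by exact_mod_cast h1, by linarith⟩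
  have e3 : ∀ n ∈ range N, |F (n / y) - ∫ t in (n : ℝ)..((n + 1 : ℕ) : ℝ), F (t / y)| ≤ L / y := by
    intro n _
    have : F (n / y) - ∫ t in (n : ℝ)..((n + 1 : ℕ) : ℝ), F (t / y) =
        ∫ t in (n : ℝ)..((n + 1 : ℕ) : ℝ), (F (n / y) - F (t / y)) := by
      rw [intervalIntegral.integral_sub (by simp) (hcont.intervalIntegrable _ _)]
      simp
    rw [this]
    have := intervalIntegral.norm_integral_le_of_norm_le_const (a := (n : ℝ))
      (b := ((n + 1 : ℕ) : ℝ)) (C := L / y) (f := fun t => F (n / y) - F (t / y)) fun t ht => by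
        rw [Set.uIoc_of_le (by push_cast; linarith), Set.mem_Ioc] at ht
        push_cast at ht
        rw [← dist_eq_norm]
        refine (hFL.dist_le_mul _ _).trans ?_
        rw [Real.dist_eq, ← sub_div, abs_div, abs_of_pos hy0, div_eq_mul_one_div (L : ℝ)]
        gcongr
        rw [abs_le]
        constructor <;> linarith
    simpa using this
  have e4 : ∑ n ∈ range N, F (n / y) - y =
      ∑ n ∈ range N, (F (n / y) - ∫ t in (n : ℝ)..((n + 1 : ℕ) : ℝ), F (t / y)) := by
    rw [sum_sub_distrib, ← e2]
  rw [e1, e4]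
  calc _ ≤ ∑ n ∈ range N, |F (n / y) - ∫ t in (n : ℝ)..((n + 1 : ℕ) : ℝ), F (t / y)| :=
        abs_sum_le_sum_abs _ _
    _ ≤ ∑ n ∈ range N, L / y := sum_le_sum e3
    _ = N * (L / y) := by simp
    _ ≤ ((B + 1) * y) * (L / y) := by
        gcongr
        linarith
    _ = _ := by field_simp

lemma weightedSum_zeta_pow_succ {j : ℕ} {A : ℝ} (hA : 0 ≤ A) (hB : 1 ≤ B) {R : ℝ → ℝ}
    (h1 : ∀ y : ℝ, 1 ≤ y → |weightedSum F B
      (((zeta : ArithmeticFunction ℕ) : ArithmeticFunction ℝ) ^ (j + 1)) y -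
        y * Real.log y ^ j / j.factorial| ≤ A * R y)
    (h2 : ∀ y : ℝ, y ≤ 1 → |weightedSum F B
      (((zeta : ArithmeticFunction ℕ) : ArithmeticFunction ℝ) ^ (j + 1)) y| ≤ A)
    (h3 : ∀ y : ℝ, 1 ≤ y → ∑ m ∈ Ioc 0 ⌊y⌋₊, R (y / m) ≤ y * (1 + Real.log y) ^ j)
    {y : ℝ} (hy : 1 ≤ y) :
    |weightedSum F B (((zeta : ArithmeticFunction ℕ) : ArithmeticFunction ℝ) ^ (j + 2)) y -
        y * Real.log y ^ (j + 1) / (j + 1).factorial| ≤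
      (A + A * B + 1) * (y * (1 + Real.log y) ^ j) := by
  have hy0 : 0 < y := by linarith
  have hl : 0 ≤ Real.log y := Real.log_nonneg hy
  set D := weightedSum F B (((zeta : ArithmeticFunction ℕ) : ArithmeticFunction ℝ) ^ (j + 1))
    with hD
  have hfl : ⌊y⌋₊ ≤ ⌊B * y⌋₊ := Nat.floor_mono (le_mul_of_one_le_left hy0.le hB)
  have e : weightedSum F B (((zeta : ArithmeticFunction ℕ) : ArithmeticFunction ℝ) ^ (j + 2)) y =
      ∑ m ∈ Ioc 0 ⌊y⌋₊, D (y / m) + ∑ m ∈ Ioc ⌊y⌋₊ ⌊B * y⌋₊, D (y / m) := by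
    rw [sum_Ioc_consecutive _ (Nat.zero_le _) hfl, pow_succ', weightedSum_mul]
    refine sum_congr rfl fun m hm => ?_
    rw [natCoe_apply, zeta_apply_ne (mem_Ioc.1 hm).1.ne', Nat.cast_one, one_mul]
  have t1 : |∑ m ∈ Ioc ⌊y⌋₊ ⌊B * y⌋₊, D (y / m)| ≤ A * (B * y) := by
    calc _ ≤ ∑ m ∈ Ioc ⌊y⌋₊ ⌊B * y⌋₊, |D (y / m)| := abs_sum_le_sum_abs _ _
      _ ≤ ∑ m ∈ Ioc ⌊y⌋₊ ⌊B * y⌋₊, A := by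
          refine sum_le_sum fun m hm => h2 _ ?_
          have := Nat.lt_of_floor_lt (mem_Ioc.1 hm).1
          exact div_le_one_of_le₀ this.le (Nat.cast_nonneg _)
      _ = A * (⌊B * y⌋₊ - ⌊y⌋₊ : ℕ) := by simp [mul_comm]
      _ ≤ A * (B * y) := by
          gcongr
          exact (Nat.cast_le.2 (Nat.sub_le _ _)).trans (Nat.floor_le (by positivity))
  have t2 : |∑ m ∈ Ioc 0 ⌊y⌋₊, (D (y / m) - (y / m) * Real.log (y / m) ^ j / j.factorial)| ≤
      A * (y * (1 + Real.log y) ^ j) := by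
    calc _ ≤ ∑ m ∈ Ioc 0 ⌊y⌋₊, |D (y / m) - (y / m) * Real.log (y / m) ^ j / j.factorial| :=
          abs_sum_le_sum_abs _ _
      _ ≤ ∑ m ∈ Ioc 0 ⌊y⌋₊, A * R (y / m) := by
          refine sum_le_sum fun m hm => h1 _ ?_
          have h := mem_Ioc.1 hm
          have hm0 : (0 : ℝ) < m := by exact_mod_cast h.1
          rw [one_le_div hm0]
          exact (Nat.le_floor_iff hy0.le).1 h.2
      _ = A * ∑ m ∈ Ioc 0 ⌊y⌋₊, R (y / m) := by rw [mul_sum]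
      _ ≤ _ := by gcongr; exact h3 y hy
  have t3 : |∑ m ∈ Ioc 0 ⌊y⌋₊, (y / m) * Real.log (y / m) ^ j / j.factorial -
      y * Real.log y ^ (j + 1) / (j + 1).factorial| ≤ y * (1 + Real.log y) ^ j := by
    have hf : (1 : ℝ) ≤ j.factorial := by exact_mod_cast j.factorial_pos
    have : ∑ m ∈ Ioc 0 ⌊y⌋₊, (y / m) * Real.log (y / m) ^ j / j.factorial -
      y * Real.log y ^ (j + 1) / (j + 1).factorial = y / j.factorial *
        (∑ m ∈ Ioc 0 ⌊y⌋₊, Real.log (y / m) ^ j / m - Real.log y ^ (j + 1) / (j + 1)) := by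
      rw [mul_sub, mul_sum, Nat.factorial_succ]
      congr 1
      · exact sum_congr rfl fun m _ => by ring
      · push_cast
        field_simp
    rw [this, abs_mul, abs_of_pos (by positivity)]
    gcongr
    · exact div_le_self hy0.le hf
    · exact sum_Ioc_log_pow_div j hy
  have hone : 1 ≤ (1 + Real.log y) ^ j := one_le_pow₀ (by linarith)
  rw [sum_sub_distrib] at t2
  rw [e]
  have t4 : A * (B * y) ≤ A * B * (y * (1 + Real.log y) ^ j) := by
    rw [mul_assoc]
    gcongr
    exact le_mul_of_one_le_right hy0.le hone
  rw [abs_le] at *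
  constructor <;> linarith

lemma sum_Ioc_div_mul_log_pow_le (j : ℕ) {y : ℝ} (hy : 1 ≤ y) :
    ∑ m ∈ Ioc 0 ⌊y⌋₊, y / m * (1 + Real.log (y / m)) ^ j ≤ y * (1 + Real.log y) ^ (j + 1) := by
  have hy0 : 0 < y := by linarith
  have hl : 0 ≤ Real.log y := Real.log_nonneg hy
  calc _ ≤ ∑ m ∈ Ioc 0 ⌊y⌋₊, y * (1 + Real.log y) ^ j * (m : ℝ)⁻¹ := by
        refine sum_le_sum fun m hm => ?_
        have h := mem_Ioc.1 hm
        have hm0 : (0 : ℝ) < m := by exact_mod_cast h.1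
        have hm1 : (1 : ℝ) ≤ m := by exact_mod_cast h.1
        have hym : 1 ≤ y / m := (one_le_div hm0).2 ((Nat.le_floor_iff hy0.le).1 h.2)
        have := Real.log_nonneg hym
        calc y / m * (1 + Real.log (y / m)) ^ j ≤ y / m * (1 + Real.log y) ^ j := by
              gcongr
              exact div_le_self hy0.le hm1
          _ = _ := by ring
    _ = y * (1 + Real.log y) ^ j * ∑ m ∈ Ioc 0 ⌊y⌋₊, (m : ℝ)⁻¹ := by rw [mul_sum]
    _ ≤ y * (1 + Real.log y) ^ j * (1 + Real.log y) := by
        gcongr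
        have := harmonic_floor_le_one_add_log y hy
        rw [harmonic_eq_sum_Icc] at this
        push_cast at this
        exact this
    _ = _ := by ring

lemma exists_weightedSum_zeta_pow_bound (hFs : Function.support F ⊆ Set.Ioc 0 B)
    (hFL : LipschitzWith L F) (hFi : ∫ u, F u = 1) (hB : 1 ≤ B) (j : ℕ) :
    ∃ A : ℝ, 0 ≤ A ∧ (∀ y : ℝ, 1 ≤ y → |weightedSum F B
        (((zeta : ArithmeticFunction ℕ) : ArithmeticFunction ℝ) ^ (j + 2)) y -
        y * Real.log y ^ (j + 1) / (j + 1).factorial| ≤ A * (y * (1 + Real.log y) ^ j)) ∧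
      ∀ y : ℝ, y ≤ 1 → |weightedSum F B
        (((zeta : ArithmeticFunction ℕ) : ArithmeticFunction ℝ) ^ (j + 2)) y| ≤ A := by
  have hB0 : 0 ≤ B := by linarith
  have small : ∀ i : ℕ, ∃ A : ℝ, 0 ≤ A ∧ ∀ y : ℝ, y ≤ 1 → |weightedSum F B
        (((zeta : ArithmeticFunction ℕ) : ArithmeticFunction ℝ) ^ i) y| ≤ A := fun i =>
    ⟨_, by positivity, fun y hy => abs_weightedSum_le_of_le_one hFs hFL hB0 _ hy⟩
  suffices h : ∃ A : ℝ, 0 ≤ A ∧ ∀ y : ℝ, 1 ≤ y → |weightedSum F B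
        (((zeta : ArithmeticFunction ℕ) : ArithmeticFunction ℝ) ^ (j + 2)) y -
        y * Real.log y ^ (j + 1) / (j + 1).factorial| ≤ A * (y * (1 + Real.log y) ^ j) by
    obtain ⟨A, hA, h1⟩ := h
    obtain ⟨A', hA', h2⟩ := small (j + 2)
    refine ⟨max A A', le_max_of_le_left hA, fun y hy => (h1 y hy).trans ?_,
      fun y hy => (h2 y hy).trans (le_max_right _ _)⟩
    have := Real.log_nonneg hy
    gcongr
    exact le_max_left _ _
  induction j with
  | zero =>
    obtain ⟨A', hA', h2⟩ := small 1
    have hLB : 0 ≤ (L : ℝ) * (B + 1) := by positivity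
    refine ⟨_, by positivity, fun y hy => weightedSum_zeta_pow_succ
      (A := max (L * (B + 1)) A') (le_max_of_le_left hLB) hB (R := fun _ => 1) ?_ ?_ ?_ hy⟩
    · intro y hy
      have := weightedSum_zeta_bound hFs hFL hFi hB0 hy
      simpa using Or.inl this
    · exact fun y hy => (h2 y hy).trans (le_max_right _ _)
    · intro y hy
      simpa using Nat.floor_le (by linarith : (0 : ℝ) ≤ y)
  | succ j ih =>
    obtain ⟨A, hA, h1⟩ := ih
    obtain ⟨A', hA', h2⟩ := small (j + 2)
    refine ⟨_, by positivity, fun y hy => weightedSum_zeta_pow_succ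
      (A := max A A') (le_max_of_le_left hA) hB
      (R := fun y => y * (1 + Real.log y) ^ j) ?_ ?_ ?_ hy⟩
    · intro y hy
      have := Real.log_nonneg hy
      refine (h1 y hy).trans ?_
      gcongr
      exact le_max_left _ _
    · exact fun y hy => (h2 y hy).trans (le_max_right _ _)
    · exact fun y hy => sum_Ioc_div_mul_log_pow_le j hy

lemma weightedSum_eq_zero {y : ℝ} (hy : B * y < 1) (f : ArithmeticFunction ℝ) :
    weightedSum F B f y = 0 := by
  rw [weightedSum, Nat.floor_eq_zero.2 hy, Ioc_self, sum_empty]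

lemma exists_weightedSum_zeta_pow_div_bound (hFs : Function.support F ⊆ Set.Ioc 0 B)
    (hFL : LipschitzWith L F) (hFi : ∫ u, F u = 1) (hB : 1 ≤ B) (j : ℕ) :
    ∃ A : ℝ, 0 ≤ A ∧ ∀ X : ℝ, 2 ≤ X → ∀ m : ℕ, 1 ≤ m → |weightedSum F B
        (((zeta : ArithmeticFunction ℕ) : ArithmeticFunction ℝ) ^ (j + 2)) (X / m) -
        X * Real.log X ^ (j + 1) / (j + 1).factorial * (1 / m)| ≤
      A * (X * Real.log X ^ j) * ((1 + Real.log m) / m) := by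
  obtain ⟨A, hA, h1, h2⟩ := exists_weightedSum_zeta_pow_bound hFs hFL hFi hB j
  refine ⟨A * B * 3 ^ j + 1, by positivity, fun X hX m hm => ?_⟩
  set D := weightedSum F B (((zeta : ArithmeticFunction ℕ) : ArithmeticFunction ℝ) ^ (j + 2))
  have hX0 : 0 < X := by linarith
  have hm0 : (0 : ℝ) < m := by exact_mod_cast hm
  have hm1 : (1 : ℝ) ≤ m := by exact_mod_cast hm
  have hlm : 0 ≤ Real.log m := Real.log_nonneg hm1
  have hlX : 1 / 2 ≤ Real.log X := by
    have := Real.log_two_gt_d9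
    have := Real.log_le_log two_pos hX
    linarith
  have hfact : ((j : ℝ) + 1) ≤ (j + 1).factorial := by exact_mod_cast Nat.self_le_factorial (j + 1)
  have hfact1 : (1 : ℝ) ≤ (j + 1).factorial := by exact_mod_cast (j + 1).factorial_pos
  set y := X / m with hy
  have hy0 : 0 < y := by positivity
  have hlogy : Real.log y = Real.log X - Real.log m := Real.log_div hX0.ne' hm0.ne'
  have hmain : X * Real.log X ^ (j + 1) / (j + 1).factorial * (1 / m) =
      y * Real.log X ^ (j + 1) / (j + 1).factorial := by rw [hy]; ring
  have hrhs : (A * B * 3 ^ j + 1) * (X * Real.log X ^ j) * ((1 + Real.log m) / m) =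
      (A * B * 3 ^ j * (y * Real.log X ^ j) + y * Real.log X ^ j) * (1 + Real.log m) := by
    rw [hy]; ring
  suffices h : |D y - y * Real.log X ^ (j + 1) / (j + 1).factorial| ≤
      A * B * 3 ^ j * (y * Real.log X ^ j) + y * Real.log X ^ j * Real.log m by
    rw [hmain, hrhs]
    have e1 : 0 ≤ A * B * 3 ^ j * (y * Real.log X ^ j) * Real.log m := by positivity
    have e2 : 0 ≤ y * Real.log X ^ j := by positivity
    linarith
  rcases le_or_gt (m : ℝ) X with hmX | hmX
  · have hy1 : 1 ≤ y := (one_le_div hm0).2 hmX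
    have hly : 0 ≤ Real.log y := Real.log_nonneg hy1
    have t1 := h1 y hy1
    have t2 : A * (y * (1 + Real.log y) ^ j) ≤ A * B * 3 ^ j * (y * Real.log X ^ j) := by
      calc A * (y * (1 + Real.log y) ^ j) ≤ A * (y * (3 * Real.log X) ^ j) := by
            gcongr
            linarith
        _ = A * 1 * 3 ^ j * (y * Real.log X ^ j) := by ring
        _ ≤ _ := by gcongr
    have hle : Real.log y ≤ Real.log X := by linarith
    have t3 := (pow_succ_sub_pow_succ_bounds hly hle j).2
    have t4 : |y * Real.log y ^ (j + 1) / (j + 1).factorial -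
        y * Real.log X ^ (j + 1) / (j + 1).factorial| ≤ y * Real.log X ^ j * Real.log m := by
      rw [abs_sub_comm, ← sub_div, ← mul_sub, abs_of_nonneg (by
        have : Real.log y ^ (j + 1) ≤ Real.log X ^ (j + 1) := by gcongr
        have := sub_nonneg.2 this
        positivity), div_le_iff₀ (by positivity)]
      calc _ ≤ y * ((j + 1) * Real.log X ^ j * (Real.log X - Real.log y)) := by gcongr
        _ = y * Real.log X ^ j * Real.log m * (j + 1) := by rw [hlogy]; ring
        _ ≤ _ := by gcongr
    have := abs_sub_le (D y) (y * Real.log y ^ (j + 1) / (j + 1).factorial)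
      (y * Real.log X ^ (j + 1) / (j + 1).factorial)
    linarith
  · have hy1 : y ≤ 1 := (div_le_one hm0).2 hmX.le
    have t1 : |D y| ≤ A * B * y := by
      rcases lt_or_ge (B * y) 1 with hBy | hBy
      · rw [show D y = 0 from weightedSum_eq_zero hBy _, abs_zero]
        positivity
      · rw [mul_assoc]
        exact (h2 y hy1).trans (le_mul_of_one_le_right hA hBy)
    have t2 : A * B * y ≤ A * B * 3 ^ j * (y * Real.log X ^ j) := by
      have : 1 ≤ (3 * Real.log X) ^ j := one_le_pow₀ (by linarith)
      calc A * B * y ≤ A * B * y * (3 * Real.log X) ^ j :=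
            le_mul_of_one_le_right (by positivity) this
        _ = _ := by ring
    have t3 : |y * Real.log X ^ (j + 1) / (j + 1).factorial| ≤
        y * Real.log X ^ j * Real.log m := by
      rw [abs_of_nonneg (by positivity)]
      calc _ ≤ y * Real.log X ^ (j + 1) := div_le_self (by positivity) hfact1
        _ = y * Real.log X ^ j * Real.log X := by ring
        _ ≤ _ := by
          gcongr
    have := abs_sub (D y) (y * Real.log X ^ (j + 1) / (j + 1).factorial)
    linarith

end SmoothDivisorSums

open ArithmeticFunction Finset in
lemma exists_weightedSum_coprimeDkSq_bound {F : ℝ → ℝ} {B : ℝ} {L : NNReal}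
    (hFs : Function.support F ⊆ Set.Ioc 0 B) (hFL : LipschitzWith L F) (hFi : ∫ u, F u = 1)
    (hB : 1 ≤ B) {k : ℕ} (hk : 2 ≤ k) {C : ℝ} (hC : 0 ≤ C) {ε : ℝ} (hε : 0 < ε) :
    ∃ A : ℝ, ∀ X : ℝ, 2 ≤ X → ∀ q : ℕ, 1 ≤ q → (q : ℝ) ≤ X ^ C →
      |weightedSum F B (coprimeDkSq k q) X -
          aCstQ k q / ((k ^ 2 - 1).factorial : ℝ) * X * Real.log X ^ (k ^ 2 - 1)| ≤
        A * X * (Real.log X ^ (k ^ 2 - 2) * Real.log X ^ ε) := by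
  have hk1 : 1 ≤ k := by omega
  obtain ⟨j, hj⟩ : ∃ j, k ^ 2 = j + 2 := Nat.exists_eq_add_of_le' (by nlinarith)
  obtain ⟨A, hA, hAD⟩ := exists_weightedSum_zeta_pow_div_bound hFs hFL hFi hB j
  obtain ⟨A', hA', hAg⟩ := exists_sum_abs_dkSqQuotient_le hk1 C hε
  refine ⟨A * A' * (2 * Real.exp 4) ^ ε, fun X hX q hq hqX => ?_⟩
  have hX0 : 0 < X := by linarith
  have hlX : 1 / 2 ≤ Real.log X := by
    have := Real.log_two_gt_d9
    have := Real.log_le_log two_pos hX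
    linarith
  rw [show k ^ 2 - 1 = j + 1 by omega, show k ^ 2 - 2 = j by omega]
  set D := weightedSum F B (((zeta : ArithmeticFunction ℕ) : ArithmeticFunction ℝ) ^ (j + 2))
    with hD
  set c := X * Real.log X ^ (j + 1) / (j + 1).factorial with hc
  have hs1 : HasSum (fun m : ℕ => dkSqQuotient k q m * D (X / m))
      (weightedSum F B (coprimeDkSq k q) X) := by
    rw [← zeta_pow_mul_dkSqQuotient, mul_comm, weightedSum_mul, hj]
    refine hasSum_sum_of_ne_finset_zero fun m hm => ?_
    rcases Nat.eq_zero_or_pos m with rfl | hm0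
    · rw [ArithmeticFunction.map_zero, zero_mul]
    · rw [mem_Ioc, not_and, not_le] at hm
      rw [hD, weightedSum_eq_zero, mul_zero]
      rw [← mul_div_assoc, div_lt_one (by exact_mod_cast hm0)]
      exact Nat.lt_of_floor_lt (hm hm0)
  have hs2 : HasSum (fun m : ℕ => c * (dkSqQuotient k q m / m)) (c * aCstQ k q) := by
    rw [← tsum_dkSqQuotient_div hk1 hq]
    exact (summable_abs_dkSqQuotient_div hk1 hq).of_norm.hasSum.mul_left c
  have hs3 := (summable_dkSqQuotient_div hk1 hq).hasSum.mul_left (A * (X * Real.log X ^ j))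
  have hmain := tsum_of_norm_bounded hs3
    (f := fun m : ℕ => dkSqQuotient k q m * D (X / m) - c * (dkSqQuotient k q m / m)) fun m => by
      rcases Nat.eq_zero_or_pos m with rfl | hm0
      · simp
      · rw [show dkSqQuotient k q m * D (X / m) - c * (dkSqQuotient k q m / m) =
          dkSqQuotient k q m * (D (X / m) - c * (1 / m)) by ring, norm_mul, Real.norm_eq_abs,
          Real.norm_eq_abs, mul_left_comm]
        gcongr
        exact hAD X hX m hm0
  rw [(hs1.sub hs2).tsum_eq, Real.norm_eq_abs] at hmain
  rw [show aCstQ k q / ((j + 1).factorial : ℝ) * X * Real.log X ^ (j + 1) = c * aCstQ k q by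
    rw [hc]; ring]
  refine hmain.trans ?_
  set Y := max (Real.exp 4) (Real.log X) with hY
  have hlq : Real.log q ≤ C * Y := by
    calc Real.log q ≤ Real.log (X ^ C) := Real.log_le_log (by exact_mod_cast hq) hqX
      _ = C * Real.log X := Real.log_rpow hX0 C
      _ ≤ C * Y := by gcongr; exact le_max_right _ _
  have hYX : Y ≤ 2 * Real.exp 4 * Real.log X := by
    have h4 : 1 ≤ Real.exp 4 := Real.one_le_exp (by norm_num)
    exact max_le (by nlinarith) (by nlinarith)
  have htsum : ∑' m : ℕ, |dkSqQuotient k q m| * ((1 + Real.log m) / m) ≤ A' * Y ^ ε :=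
    Real.tsum_le_of_sum_range_le (fun m => by
      have := Real.log_natCast_nonneg m
      positivity) (hAg Y (le_max_left _ _) q hq hlq)
  have hYε : Y ^ ε ≤ (2 * Real.exp 4) ^ ε * Real.log X ^ ε := by
    rw [← Real.mul_rpow (by positivity) (by positivity)]
    have : 0 ≤ Y := (Real.exp_pos 4).le.trans (le_max_left _ _)
    gcongr
  calc _ ≤ A * (X * Real.log X ^ j) * (A' * ((2 * Real.exp 4) ^ ε * Real.log X ^ ε)) := by
        gcongr
        exact htsum.trans (by gcongr)
    _ = _ := by ring

/-- diagonal asymptotics for a fixed modulus, uniformly for `q ≤ X^C`. -/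
theorem diagonal_fixed_modulus (k : ℕ) (hk : 2 ≤ k) (C : ℝ) (hC : 0 < C)
    (ε : ℝ) (hε : 0 < ε)
    (Ψ : ℝ → ℝ)
    (hΨsmooth : ContDiff ℝ (⊤ : ℕ∞) Ψ) (hΨsupp : HasCompactSupport Ψ)
    (hΨpos : ∀ x, 0 ≤ Ψ x) (hΨsupp' : tsupport Ψ ⊆ Set.Ioi 0)
    (hΨint : ∫ u, (Ψ u)^2 = 1) :
    ∃ Cε : ℝ, ∀ X : ℝ, 2 ≤ X → ∀ q : ℕ, 1 ≤ q → (q : ℝ) ≤ X ^ C →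
      |(∑' n : ℕ, if Nat.gcd n q = 1 then (dk k n : ℝ)^2 * (Ψ ((n : ℝ) / X))^2 else 0) -
          (aCstQ k q / ((k^2 - 1).factorial : ℝ)) * X * (Real.log X)^(k^2 - 1)| ≤
        Cε * X * (Real.log X) ^ ((k^2 : ℝ) - 2 + ε) := by
  have hcont : ContDiff ℝ (⊤ : ℕ∞) fun u => Ψ u ^ 2 := hΨsmooth.pow 2
  have hcpt : HasCompactSupport fun u => Ψ u ^ 2 :=
    hΨsupp.comp_left (g := fun x : ℝ => x ^ 2) (by simp)
  obtain ⟨L, hL⟩ := ContDiff.lipschitzWith_of_hasCompactSupport hcpt hcont (by simp)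
  obtain ⟨b, hb⟩ := hΨsupp.isCompact.bddAbove
  set B := max 1 b
  have hsupp : Function.support (fun u => Ψ u ^ 2) ⊆ Set.Ioc 0 B := fun u hu => by
    have hu' : u ∈ tsupport Ψ := subset_tsupport Ψ fun h => hu (by simp [h])
    exact ⟨hΨsupp' hu', (hb hu').trans (le_max_right _ _)⟩
  obtain ⟨A, hA⟩ :=
    exists_weightedSum_coprimeDkSq_bound hsupp hL hΨint (le_max_left 1 b) hk hC.le hε
  refine ⟨A, fun X hX q hq hqX => ?_⟩
  have hX0 : 0 < X := by linarith
  have hlX : 0 < Real.log X := Real.log_pos (by linarith)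
  have e1 : (∑' n : ℕ, if Nat.gcd n q = 1 then (dk k n : ℝ) ^ 2 * (Ψ ((n : ℝ) / X)) ^ 2 else 0) =
      weightedSum (fun u => Ψ u ^ 2) B (coprimeDkSq k q) X := by
    have : ∀ n : ℕ, (if Nat.gcd n q = 1 then (dk k n : ℝ) ^ 2 * (Ψ ((n : ℝ) / X)) ^ 2 else 0) =
        coprimeDkSq k q n * Ψ (n / X) ^ 2 := fun n => by
      rw [coprimeDkSq_apply, ite_mul, zero_mul]
    simp_rw [this]
    refine tsum_eq_sum fun n hn => ?_
    by_contra h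
    have hs := hsupp (right_ne_zero_of_mul h)
    rw [Set.mem_Ioc, div_le_iff₀ hX0] at hs
    refine hn (Finset.mem_Ioc.2 ⟨Nat.pos_of_ne_zero ?_, Nat.le_floor hs.2⟩)
    rintro rfl
    simp at hs
  have e2 : Real.log X ^ ((k ^ 2 : ℝ) - 2 + ε) =
      Real.log X ^ (k ^ 2 - 2) * Real.log X ^ ε := by
    have hk2 : 2 ≤ k ^ 2 := by nlinarith
    rw [Real.rpow_add hlX, ← Real.rpow_natCast (Real.log X), Nat.cast_sub hk2,
      Nat.cast_pow, Nat.cast_ofNat]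
  rw [e1, e2]
  exact hA X hX q hq hqX
end

section
/- Fix an integer k ≥ 2 and ε > 0. There is a constant C_ε such that for all Q ≥ 1, | Σ_{q≥1} a_k(q) Φ(q/Q) − ã_k Q | ≤ C_ε · Q^{1/2+ε}. -/
open MeasureTheory

/-- `ã_k`. -/
noncomputable def aTilde (k : ℕ) : ℝ :=
  aCst k * ∏' p : Nat.Primes, (1 - (1 - (frakA k p)⁻¹)/((p : ℕ) : ℝ))

/-- The set of primes dividing `q`, as a finset of `Nat.Primes`. -/
def primeDivisors (q : ℕ) : Finset Nat.Primes := q.primeFactors.subtype Nat.Prime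

theorem mem_primeDivisors {q : ℕ} {p : Nat.Primes} :
    p ∈ primeDivisors q ↔ (p : ℕ) ∣ q ∧ q ≠ 0 := by
  refine Finset.mem_subtype.trans ?_
  rw [Nat.mem_primeFactors]
  exact and_iff_right p.2

theorem prod_dvd_iff_subset_primeDivisors {q : ℕ} (hq : q ≠ 0) (S : Finset Nat.Primes) :
    (∏ p ∈ S, (p : ℕ)) ∣ q ↔ S ⊆ primeDivisors q := by
  constructor
  · intro h p hp
    exact mem_primeDivisors.2
      ⟨(Finset.dvd_prod_of_mem (fun p : Nat.Primes => (p : ℕ)) hp).trans h, hq⟩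
  · intro h
    have := Finset.prod_primes_dvd (s := S.map ⟨fun p : Nat.Primes => (p : ℕ), Subtype.val_injective⟩)
      q ?_ ?_
    · rwa [Finset.prod_map] at this
    · intro a ha
      obtain ⟨p, -, rfl⟩ := Finset.mem_map.1 ha
      exact p.2.prime
    · intro a ha
      obtain ⟨p, hp, rfl⟩ := Finset.mem_map.1 ha
      exact (mem_primeDivisors.1 (h hp)).1

theorem prod_primeFactors_eq_sum_powerset (f : ℕ → ℝ) (q : ℕ) :
    ∏ p ∈ q.primeFactors, f p =
      ∑ S ∈ (primeDivisors q).powerset, ∏ p ∈ S, (f (p : Nat.Primes) - 1) := by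
  rw [← Finset.prod_one_add]
  simp only [add_sub_cancel]
  exact (Finset.prod_subtype_of_mem f fun p hp => Nat.prime_of_mem_primeFactors hp).symm

theorem prod_primeFactors_eq_tsum (f : ℕ → ℝ) {q : ℕ} (hq : q ≠ 0) :
    ∏ p ∈ q.primeFactors, f p =
      ∑' S : Finset Nat.Primes,
        if (∏ p ∈ S, (p : ℕ)) ∣ q then ∏ p ∈ S, (f (p : Nat.Primes) - 1) else 0 := by
  rw [prod_primeFactors_eq_sum_powerset, tsum_eq_sum (s := (primeDivisors q).powerset)]
  · refine Finset.sum_congr rfl fun S hS => ?_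
    rw [if_pos ((prod_dvd_iff_subset_primeDivisors hq S).2 (Finset.mem_powerset.1 hS))]
  · intro S hS
    rw [if_neg]
    rwa [prod_dvd_iff_subset_primeDivisors hq, ← Finset.mem_powerset]

theorem summable_choose_sq_div_two_pow (k : ℕ) :
    Summable fun ℓ : ℕ => ((k + ℓ - 1).choose (k - 1) : ℝ) ^ 2 / (2 : ℝ) ^ ℓ := by
  have h := summable_pow_mul_geometric_of_norm_lt_one (R := ℝ) (2 * k) (r := 1 / 2)
    (by norm_num)
  have h' := ((summable_nat_add_iff 1).2 h).mul_left ((2 : ℝ) * ((k : ℝ) + 1) ^ (2 * k))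
  refine Summable.of_nonneg_of_le (fun ℓ => by positivity) (fun ℓ => ?_) h'
  have h1 : (k + ℓ - 1).choose (k - 1) ≤ ((k + 1) * (ℓ + 1)) ^ k := by
    refine (Nat.choose_le_pow _ _).trans ?_
    calc (k + ℓ - 1) ^ (k - 1) ≤ ((k + 1) * (ℓ + 1)) ^ (k - 1) := by
          gcongr
          nlinarith [Nat.sub_le (k + ℓ) 1]
      _ ≤ _ := Nat.pow_le_pow_right (by positivity) (Nat.sub_le _ _)
  have h2 : ((k + ℓ - 1).choose (k - 1) : ℝ) ≤ (((k : ℝ) + 1) * (ℓ + 1)) ^ k := by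
    exact_mod_cast h1
  calc ((k + ℓ - 1).choose (k - 1) : ℝ) ^ 2 / (2 : ℝ) ^ ℓ
      ≤ ((((k : ℝ) + 1) * (ℓ + 1)) ^ k) ^ 2 / (2 : ℝ) ^ ℓ := by gcongr
    _ = _ := by
        push_cast
        rw [one_div, inv_pow, pow_succ (2 : ℝ) ℓ, ← pow_mul, mul_comm k 2, mul_pow]
        field_simp

/-- `𝔞_p = 1 + O(1/p)` from above and `1 ≤ 𝔞_p`. -/
theorem exists_frakA_bound (k : ℕ) :
    ∃ C : ℝ, 0 ≤ C ∧ ∀ p : ℕ, 2 ≤ p → 1 ≤ frakA k p ∧ frakA k p ≤ 1 + C / p := by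
  set c : ℕ → ℝ := fun ℓ => ((k + ℓ - 1).choose (k - 1) : ℝ) ^ 2 with hc
  have hc0 : c 0 = 1 := by simp [hc]
  have hcn : ∀ ℓ, 0 ≤ c ℓ := fun ℓ => by positivity
  have hs : Summable fun ℓ => c ℓ / (2 : ℝ) ^ ℓ := summable_choose_sq_div_two_pow k
  have hs1 : Summable fun ℓ => c (ℓ + 1) / (2 : ℝ) ^ (ℓ + 1) :=
    (summable_nat_add_iff (f := fun ℓ => c ℓ / (2 : ℝ) ^ ℓ) 1).2 hs
  have hle : ∀ p : ℕ, 2 ≤ p → ∀ ℓ, c (ℓ + 1) / (p : ℝ) ^ (ℓ + 1) ≤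
      2 / p * (c (ℓ + 1) / (2 : ℝ) ^ (ℓ + 1)) := by
    intro p hp ℓ
    have hp' : (2 : ℝ) ≤ p := by exact_mod_cast hp
    have e : 2 / (p : ℝ) * (c (ℓ + 1) / (2 : ℝ) ^ (ℓ + 1)) = c (ℓ + 1) / (p * 2 ^ ℓ) := by
      rw [pow_succ]; field_simp
    rw [e, pow_succ']
    have := hcn (ℓ + 1)
    gcongr
  refine ⟨2 * ∑' ℓ, c (ℓ + 1) / (2 : ℝ) ^ (ℓ + 1), ?_, fun p hp => ?_⟩
  · exact mul_nonneg zero_le_two (tsum_nonneg fun ℓ => div_nonneg (hcn _) (by positivity))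
  have hsp1 : Summable fun ℓ => c (ℓ + 1) / (p : ℝ) ^ (ℓ + 1) :=
    Summable.of_nonneg_of_le (fun ℓ => div_nonneg (hcn _) (by positivity)) (hle p hp)
      (hs1.mul_left _)
  have hsp : Summable fun ℓ => c ℓ / (p : ℝ) ^ ℓ :=
    (summable_nat_add_iff (f := fun ℓ => c ℓ / (p : ℝ) ^ ℓ) 1).1 hsp1
  have hA : frakA k p = 1 + ∑' ℓ, c (ℓ + 1) / (p : ℝ) ^ (ℓ + 1) := by
    have := hsp.tsum_eq_zero_add
    rw [hc0, pow_zero, div_one] at this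
    exact this
  rw [hA]
  constructor
  · exact le_add_of_nonneg_right
      (tsum_nonneg fun ℓ => div_nonneg (hcn _) (pow_nonneg p.cast_nonneg _))
  · have := hsp1.tsum_le_tsum (hle p hp) (hs1.mul_left _)
    rw [tsum_mul_left] at this
    have e : (2 * ∑' ℓ, c (ℓ + 1) / (2 : ℝ) ^ (ℓ + 1)) / (p : ℝ) =
      2 / p * ∑' ℓ, c (ℓ + 1) / (2 : ℝ) ^ (ℓ + 1) := by ring
    linarith

theorem exists_abs_inv_frakA_sub_one_le (k : ℕ) :
    ∃ C : ℝ, 0 ≤ C ∧ ∀ p : ℕ, 2 ≤ p → |(frakA k p)⁻¹ - 1| ≤ C / p := by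
  obtain ⟨C, hC, h⟩ := exists_frakA_bound k
  refine ⟨C, hC, fun p hp => ?_⟩
  obtain ⟨h1, h2⟩ := h p hp
  have h0 : 0 < frakA k p := by linarith
  have h3 : (frakA k p)⁻¹ ≤ 1 := inv_le_one_of_one_le₀ h1
  have h4 : frakA k p * (frakA k p)⁻¹ = 1 := mul_inv_cancel₀ h0.ne'
  rw [abs_of_nonpos (by linarith)]
  nlinarith

/-- Absolute convergence at exponent `1/2` of the Dirichlet series attached to
`∏_{p ∣ d} (𝔞_p⁻¹ - 1)`. -/
theorem summable_prod_abs_inv_frakA_sub_one (k : ℕ) :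
    Summable fun S : Finset Nat.Primes =>
      ∏ p ∈ S, (|(frakA k (p : ℕ))⁻¹ - 1| * ((p : ℕ) : ℝ) ^ (-(1 / 2) : ℝ)) := by
  obtain ⟨C, hC, h⟩ := exists_abs_inv_frakA_sub_one_le k
  apply summable_finsetProd_of_summable_nonneg
  · exact fun p => mul_nonneg (abs_nonneg _) (Real.rpow_nonneg (Nat.cast_nonneg _) _)
  · have hs := (Nat.Primes.summable_rpow (r := -(3 / 2))).2 (by norm_num)
    refine Summable.of_nonneg_of_le (fun p => by positivity) (fun p => ?_) (hs.mul_left C)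
    have hp : (0 : ℝ) < (p : ℕ) := by exact_mod_cast p.2.pos
    have e : ((p : ℕ) : ℝ) ^ (-(3 / 2) : ℝ) = (p : ℝ)⁻¹ * (p : ℝ) ^ (-(1 / 2) : ℝ) := by
      rw [← Real.rpow_neg_one, ← Real.rpow_add hp]; norm_num
    rw [e, ← mul_assoc, ← div_eq_mul_inv]
    gcongr
    exact h p p.2.two_le

/-- Comparison of the sum of a smooth bump over a lattice `hℤ` with its integral. -/
theorem exists_abs_tsum_sub_inv_le (Φ : ℝ → ℝ)
    (hΦsmooth : ContDiff ℝ (⊤ : ℕ∞) Φ) (hΦsupp : HasCompactSupport Φ)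
    (hΦsupp' : tsupport Φ ⊆ Set.Ioi 0) (hΦint : ∫ u, Φ u = 1) :
    ∃ C : ℝ, 0 ≤ C ∧ ∀ h : ℝ, 0 < h →
      |(∑' m : ℕ, Φ (m * h)) - h⁻¹| ≤ C * h ^ (-(1 / 2) : ℝ) := by
  obtain ⟨L, hL⟩ := ContDiff.lipschitzWith_of_hasCompactSupport hΦsupp hΦsmooth (by simp)
  obtain ⟨R, hR0, hR⟩ : ∃ R : ℝ, 0 < R ∧ ∀ x, R ≤ x → Φ x = 0 := by
    obtain ⟨R, hR⟩ := hΦsupp.isCompact.bddAbove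
    refine ⟨|R| + 1, by positivity, fun x hx => ?_⟩
    by_contra hne
    have := hR (subset_tsupport Φ (Function.mem_support.2 hne))
    linarith [le_abs_self R]
  have hneg : ∀ x, x ≤ 0 → Φ x = 0 := fun x hx => by
    by_contra hne
    exact not_lt.2 hx (hΦsupp' (subset_tsupport Φ (Function.mem_support.2 hne)))
  have hcont : Continuous Φ := hΦsmooth.continuous
  have hL0 : (0 : ℝ) ≤ L := L.2
  have hsmall : ∀ h : ℝ, 0 < h → h ≤ R → |(∑' m : ℕ, Φ (m * h)) - h⁻¹| ≤ 2 * L * R := by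
    intro h h0 hle
    set N : ℕ := ⌈R / h⌉₊ with hN
    have hN1 : R ≤ N * h := by
      rw [← div_le_iff₀ h0]; exact Nat.le_ceil _
    have hN2 : N * h ≤ 2 * R := by
      have : (N : ℝ) < R / h + 1 := Nat.ceil_lt_add_one (by positivity)
      calc N * h ≤ (R / h + 1) * h := by gcongr
        _ = R + h := by field_simp
        _ ≤ 2 * R := by linarith
    have hsum : ∑' m : ℕ, Φ (m * h) = ∑ m ∈ Finset.range N, Φ (m * h) := by
      refine tsum_eq_sum fun m hm => hR _ (hN1.trans ?_)
      have : (N : ℝ) ≤ m := by exact_mod_cast not_lt.1 (mt Finset.mem_range.2 hm)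
      gcongr
    have hsumint : ∑ m ∈ Finset.range N, ∫ u in ((m : ℕ) * h)..((m + 1 : ℕ) * h), Φ u = 1 := by
      rw [intervalIntegral.sum_integral_adjacent_intervals (a := fun m : ℕ => (m : ℝ) * h)
        fun m _ => hcont.intervalIntegrable _ _, ← hΦint]
      apply intervalIntegral.integral_eq_integral_of_support_subset
      intro x hx
      rw [Function.mem_support] at hx
      constructor
      · by_contra hc
        exact hx (hneg x (by simpa using hc))
      · by_contra hc
        exact hx (hR x (hN1.trans (not_le.1 hc).le))
    have hterm : ∀ m : ℕ,
        |h * Φ (m * h) - ∫ u in ((m : ℕ) * h)..((m + 1 : ℕ) * h), Φ u| ≤ L * h * h := by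
      intro m
      have e : ((m + 1 : ℕ) : ℝ) * h - m * h = h := by push_cast; ring
      have hconst : h * Φ (m * h) = ∫ _ in ((m : ℕ) * h)..((m + 1 : ℕ) * h), Φ (m * h) := by
        rw [intervalIntegral.integral_const, e, smul_eq_mul]
      rw [hconst, ← intervalIntegral.integral_sub (by simp) (hcont.intervalIntegrable _ _),
        ← Real.norm_eq_abs]
      have := intervalIntegral.norm_integral_le_of_norm_le_const
        (a := (m : ℝ) * h) (b := (m + 1 : ℕ) * h) (C := L * h)
        (f := fun u => Φ (m * h) - Φ u) ?_
      · rwa [e, abs_of_pos h0] at this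
      · intro x hx
        rw [Set.uIoc_of_le (by linarith)] at hx
        have := hL.dist_le_mul (m * h) x
        rw [dist_eq_norm, dist_eq_norm, Real.norm_eq_abs (_ - x), abs_sub_comm] at this
        refine this.trans ?_
        gcongr
        rw [abs_le]
        constructor <;> linarith [hx.1, hx.2]
    have hmain : |h * (∑' m : ℕ, Φ (m * h)) - 1| ≤ 2 * L * R * h := by
      rw [hsum, Finset.mul_sum, ← hsumint, ← Finset.sum_sub_distrib]
      refine (Finset.abs_sum_le_sum_abs _ _).trans ?_
      refine (Finset.sum_le_sum fun m _ => hterm m).trans ?_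
      rw [Finset.sum_const, Finset.card_range, nsmul_eq_mul]
      calc (N : ℝ) * (L * h * h) = L * h * (N * h) := by ring
        _ ≤ L * h * (2 * R) := by gcongr
        _ = _ := by ring
    have e : (∑' m : ℕ, Φ (m * h)) - h⁻¹ = (h * (∑' m : ℕ, Φ (m * h)) - 1) / h := by
      rw [sub_div, mul_div_cancel_left₀ _ h0.ne', one_div]
    rw [e, abs_div, abs_of_pos h0, div_le_iff₀ h0]
    exact hmain
  refine ⟨2 * L * R * R ^ (1 / 2 : ℝ) + R ^ (-(1 / 2) : ℝ), by positivity, fun h h0 => ?_⟩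
  rcases le_or_gt h R with hle | hlt
  · refine (hsmall h h0 hle).trans ?_
    have h1 : 1 ≤ R ^ (1 / 2 : ℝ) * h ^ (-(1 / 2) : ℝ) := by
      rw [Real.rpow_neg h0.le, ← div_eq_mul_inv, one_le_div (by positivity)]
      gcongr
    have h2 : 0 ≤ R ^ (-(1 / 2) : ℝ) * h ^ (-(1 / 2) : ℝ) := by positivity
    have h3 : 0 ≤ 2 * L * R := by positivity
    nlinarith [mul_le_mul_of_nonneg_left h1 h3]
  · have hz : ∑' m : ℕ, Φ (m * h) = 0 := by
      rw [← tsum_zero (α := ℝ) (β := ℕ)]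
      congr 1 with m
      rcases Nat.eq_zero_or_pos m with rfl | hm
      · exact hneg _ (by simp)
      · refine hR _ ?_
        have : (1 : ℝ) ≤ m := by exact_mod_cast hm
        nlinarith
    rw [hz, zero_sub, abs_neg, abs_of_pos (by positivity)]
    have h1 : h⁻¹ = h ^ (-(1 / 2) : ℝ) * h ^ (-(1 / 2) : ℝ) := by
      rw [← Real.rpow_neg_one, ← Real.rpow_add h0]; norm_num
    have h2 : h ^ (-(1 / 2) : ℝ) ≤ R ^ (-(1 / 2) : ℝ) :=
      Real.rpow_le_rpow_of_nonpos hR0 hlt.le (by norm_num)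
    rw [h1]
    gcongr
    have : 0 ≤ 2 * L * R * R ^ (1 / 2 : ℝ) := by positivity
    linarith

theorem tsum_ite_dvd_eq_tsum_mul (f : ℕ → ℝ) {d : ℕ} (hd : d ≠ 0) :
    (∑' q : ℕ, if d ∣ q then f q else 0) = ∑' m : ℕ, f (m * d) := by
  have hinj : Function.Injective fun m : ℕ => m * d := fun a b h =>
    Nat.eq_of_mul_eq_mul_right (Nat.pos_of_ne_zero hd) h
  rw [← hinj.tsum_eq (f := fun q => if d ∣ q then f q else 0)]
  · simp
  · intro q hq
    rw [Function.mem_support] at hq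
    obtain ⟨m, rfl⟩ : d ∣ q := by
      by_contra hc
      exact hq (if_neg hc)
    exact ⟨m, mul_comm _ _⟩

/-- Opening the product over primes and interchanging the order of summation. -/
theorem tsum_prod_primeFactors_mul_eq (b : ℕ → ℝ) (f : ℕ → ℝ) (hf0 : f 0 = 0)
    (hf : f.support.Finite) :
    (∑' q : ℕ, if 1 ≤ q then (∏ p ∈ q.primeFactors, b p) * f q else 0) =
      ∑' S : Finset Nat.Primes, (∏ p ∈ S, (b (p : Nat.Primes) - 1)) *
        ∑' m : ℕ, f (m * ∏ p ∈ S, (p : ℕ)) := by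
  have hz : ∀ q ∉ hf.toFinset, f q = 0 := fun q hq => by simpa using hq
  have hne : ∀ q ∈ hf.toFinset, q ≠ 0 := by
    rintro q hq rfl
    simp [hf0] at hq
  have hsummable : ∀ q ∈ hf.toFinset, Summable fun S : Finset Nat.Primes =>
      (if (∏ p ∈ S, (p : ℕ)) ∣ q then ∏ p ∈ S, (b (p : Nat.Primes) - 1) else 0) * f q := by
    intro q hq
    refine (summable_of_ne_finset_zero (s := (primeDivisors q).powerset) fun S hS => ?_).mul_right _
    rw [if_neg]
    rwa [prod_dvd_iff_subset_primeDivisors (hne q hq), ← Finset.mem_powerset]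
  rw [tsum_eq_sum (s := hf.toFinset) fun q hq => by simp [hz q hq]]
  calc ∑ q ∈ hf.toFinset, (if 1 ≤ q then (∏ p ∈ q.primeFactors, b p) * f q else 0)
      = ∑ q ∈ hf.toFinset, ∑' S : Finset Nat.Primes,
        (if (∏ p ∈ S, (p : ℕ)) ∣ q then ∏ p ∈ S, (b (p : Nat.Primes) - 1) else 0) * f q := by
        refine Finset.sum_congr rfl fun q hq => ?_
        rw [if_pos (Nat.one_le_iff_ne_zero.2 (hne q hq)), prod_primeFactors_eq_tsum b (hne q hq),
          tsum_mul_right]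
    _ = ∑' S : Finset Nat.Primes, ∑ q ∈ hf.toFinset,
        (if (∏ p ∈ S, (p : ℕ)) ∣ q then ∏ p ∈ S, (b (p : Nat.Primes) - 1) else 0) * f q :=
        (Summable.tsum_finsetSum hsummable).symm
    _ = _ := by
        refine tsum_congr fun S => ?_
        have hd : (∏ p ∈ S, (p : ℕ)) ≠ 0 := Finset.prod_ne_zero_iff.2 fun p _ => p.2.ne_zero
        rw [← tsum_ite_dvd_eq_tsum_mul f hd,
          tsum_eq_sum (s := hf.toFinset) fun q hq => by simp [hz q hq], Finset.mul_sum]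
        refine Finset.sum_congr rfl fun q _ => ?_
        split_ifs <;> simp

/-- smoothed average of the constants `a_k(q)`. -/
theorem averaged_constants (k : ℕ) (hk : 2 ≤ k) (ε : ℝ) (hε : 0 < ε)
    (Φ : ℝ → ℝ)
    (hΦsmooth : ContDiff ℝ (⊤ : ℕ∞) Φ) (hΦsupp : HasCompactSupport Φ)
    (hΦpos : ∀ x, 0 ≤ Φ x) (hΦsupp' : tsupport Φ ⊆ Set.Ioi 0)
    (hΦint : ∫ u, Φ u = 1) :
    ∃ Cε : ℝ, ∀ Q : ℝ, 1 ≤ Q →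
      |(∑' q : ℕ, if 1 ≤ q then aCstQ k q * Φ ((q : ℝ) / Q) else 0) - aTilde k * Q| ≤
        Cε * Q ^ ((1 : ℝ)/2 + ε) := by
  obtain ⟨C, hC, hlat⟩ := exists_abs_tsum_sub_inv_le Φ hΦsmooth hΦsupp hΦsupp' hΦint
  set y : Nat.Primes → ℝ := fun p => (frakA k (p : ℕ))⁻¹ - 1 with hy
  set T : Finset Nat.Primes → ℝ := fun S => ∏ p ∈ S, (|y p| * ((p : ℕ) : ℝ) ^ (-(1 / 2) : ℝ))
    with hT
  have hTs : Summable T := summable_prod_abs_inv_frakA_sub_one k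
  have hTn : ∀ S, 0 ≤ T S := fun S => Finset.prod_nonneg fun p _ => by positivity
  refine ⟨|aCst k| * (C * ∑' S, T S), fun Q hQ => ?_⟩
  have hQ0 : 0 < Q := by linarith
  set D : Finset Nat.Primes → ℕ := fun S => ∏ p ∈ S, (p : ℕ) with hD
  have hDpos : ∀ S, (0 : ℝ) < D S := fun S => by
    exact Nat.cast_pos.2 (Finset.prod_pos fun p _ => p.2.pos)
  set w : Finset Nat.Primes → ℝ := fun S => ∏ p ∈ S, y p with hw
  have hT' : ∀ S, |w S| * (D S : ℝ) ^ (-(1 / 2) : ℝ) = T S := by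
    intro S
    simp only [hw, hD, hT]
    rw [Finset.prod_mul_distrib, Finset.abs_prod, Nat.cast_prod,
      Real.finsetProd_rpow _ _ fun p _ => Nat.cast_nonneg _]
  have hwD : ∀ S, w S / D S = ∏ p ∈ S, (y p / ((p : ℕ) : ℝ)) := by
    intro S
    simp only [hw, hD]
    rw [Finset.prod_div_distrib, Nat.cast_prod]
  have hsD : Summable fun S => w S / D S := by
    refine Summable.of_norm_bounded hTs fun S => ?_
    rw [← hT', Real.norm_eq_abs, abs_div, abs_of_pos (hDpos S), div_eq_mul_inv,
      ← Real.rpow_neg_one]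
    refine mul_le_mul_of_nonneg_left ?_ (abs_nonneg _)
    refine Real.rpow_le_rpow_of_exponent_le ?_ (by norm_num)
    exact_mod_cast hDpos S
  have htilde : aTilde k = aCst k * ∑' S, w S / D S := by
    have hs' : Summable fun S => ∏ p ∈ S, (y p / ((p : ℕ) : ℝ)) := by
      simpa only [hwD] using hsD
    simp only [hwD]
    rw [aTilde, ← tprod_one_add hs']
    congr 1
    refine tprod_congr fun p => ?_
    simp only [hy]
    ring
  set A : Finset Nat.Primes → ℝ := fun S => ∑' m : ℕ, Φ (((m * D S : ℕ) : ℝ) / Q) with hA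
  have hAb : ∀ S, |A S - Q / D S| ≤ C * (D S : ℝ) ^ (-(1 / 2) : ℝ) * Q ^ (1 / 2 : ℝ) := by
    intro S
    have := hlat (D S / Q) (div_pos (hDpos S) hQ0)
    rw [inv_div, Real.div_rpow (hDpos S).le hQ0.le, Real.rpow_neg hQ0.le (1 / 2), div_inv_eq_mul,
      ← mul_assoc] at this
    have hAS : A S = ∑' m : ℕ, Φ (m * (D S / Q)) := by
      refine tsum_congr fun m => ?_
      rw [Nat.cast_mul, mul_div_assoc]
    rwa [hAS]
  have hfin : (Function.support fun q : ℕ => Φ ((q : ℝ) / Q)).Finite := by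
    obtain ⟨R, hR⟩ := hΦsupp.isCompact.bddAbove
    refine (Set.finite_Iic ⌈R * Q⌉₊).subset fun q hq => ?_
    have := hR (subset_tsupport Φ (Function.mem_support.2 hq))
    rw [div_le_iff₀ hQ0] at this
    exact_mod_cast this.trans (Nat.le_ceil _)
  have hzero : Φ (((0 : ℕ) : ℝ) / Q) = 0 := by
    by_contra hne
    have := hΦsupp' (subset_tsupport Φ (Function.mem_support.2 hne))
    simp at this
  have hopen : (∑' q : ℕ, if 1 ≤ q then aCstQ k q * Φ ((q : ℝ) / Q) else 0) =
      aCst k * ∑' S, w S * A S := by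
    rw [← tsum_prod_primeFactors_mul_eq (fun p => (frakA k p)⁻¹) (fun q : ℕ => Φ ((q : ℝ) / Q))
      hzero hfin, ← tsum_mul_left]
    refine tsum_congr fun q => ?_
    rw [mul_ite, mul_zero, aCstQ, mul_assoc]
  have hdiff : ∀ S, |w S * (A S - Q / D S)| ≤ C * Q ^ (1 / 2 : ℝ) * T S := by
    intro S
    rw [abs_mul, ← hT']
    calc _ ≤ |w S| * (C * (D S : ℝ) ^ (-(1 / 2) : ℝ) * Q ^ (1 / 2 : ℝ)) :=
          mul_le_mul_of_nonneg_left (hAb S) (abs_nonneg _)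
      _ = _ := by ring
  have hsdiff : Summable fun S => w S * (A S - Q / D S) :=
    Summable.of_norm_bounded (hTs.mul_left _) hdiff
  have hsplit : ∑' S, w S * A S = (∑' S, w S * (A S - Q / D S)) + (∑' S, w S / D S) * Q := by
    rw [← tsum_mul_right, ← hsdiff.tsum_add (hsD.mul_right Q)]
    refine tsum_congr fun S => ?_
    ring
  rw [hopen, htilde, hsplit]
  have hE : |∑' S, w S * (A S - Q / D S)| ≤ C * Q ^ (1 / 2 : ℝ) * ∑' S, T S := by
    rw [← tsum_mul_left, ← Real.norm_eq_abs]
    exact tsum_of_norm_bounded (hTs.mul_left (C * Q ^ (1 / 2 : ℝ))).hasSum hdiff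
  have hpow : Q ^ (1 / 2 : ℝ) ≤ Q ^ ((1 : ℝ) / 2 + ε) :=
    Real.rpow_le_rpow_of_exponent_le hQ (by linarith)
  have hTsum : 0 ≤ ∑' S, T S := tsum_nonneg hTn
  have e : aCst k * ((∑' S, w S * (A S - Q / D S)) + (∑' S, w S / D S) * Q) -
      aCst k * (∑' S, w S / D S) * Q = aCst k * ∑' S, w S * (A S - Q / D S) := by ring
  rw [e, abs_mul]
  calc _ ≤ |aCst k| * (C * Q ^ (1 / 2 : ℝ) * ∑' S, T S) := by gcongr
    _ ≤ |aCst k| * (C * Q ^ ((1 : ℝ) / 2 + ε) * ∑' S, T S) := by gcongr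
    _ = _ := by ring
end
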